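/- Let n = 2 and, for θ ∈ (0,π), let Σ_θ ⊂ S¹ be an open arc of length 2θ and C_θ := C_{Σ_θ} the corresponding planar sector. Then μ_N(C_θ;0) = min{ (π²/(4θ²) − 1)², (π²/θ² − 1)² }. Moreover, with θ* := π√(5/8), one has μ_D(ℝ²₊;0) ≥ μ_D(C_{θ*};0) > μ_N(C_{θ*};0) = 9/25; in particular μ_D(ℝ²₊;0) > 9/25, whereas μ_N(ℝ²₊;0) = 0. -/

import Mathlib

open MeasureTheory Metric Set Filter
open scoped RealInnerProductSpace

noncomputable section

/-- The Euclidean Laplacian of `u : ℝⁿ → ℝ` at a point. -/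
def lap {n : ℕ} (u : EuclideanSpace ℝ (Fin n) → ℝ) (x : EuclideanSpace ℝ (Fin n)) : ℝ :=
  ∑ i : Fin n, iteratedFDeriv ℝ 2 u x ![EuclideanSpace.single i 1, EuclideanSpace.single i 1]

/-- The Laplace–Beltrami operator on the unit sphere, computed via the
`0`-homogeneous extension: for a `0`-homogeneous function the Euclidean Laplacian
restricted to the unit sphere is exactly the Laplace–Beltrami operator. -/
def sphLap {n : ℕ} (φ : EuclideanSpace ℝ (Fin n) → ℝ) (σ : EuclideanSpace ℝ (Fin n)) : ℝ :=
  lap (fun x => φ (‖x‖⁻¹ • x)) σ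

/-- Squared norm of the spherical gradient, via the `0`-homogeneous extension. -/
def sphGradNormSq {n : ℕ} (φ : EuclideanSpace ℝ (Fin n) → ℝ) (σ : EuclideanSpace ℝ (Fin n)) : ℝ :=
  ‖fderiv ℝ (fun x => φ (‖x‖⁻¹ • x)) σ‖ ^ 2

/-- The open cone `C_Σ = {rσ : r > 0, σ ∈ Σ}` over a subset of the unit sphere. -/
def coneOf {n : ℕ} (S : Set (EuclideanSpace ℝ (Fin n))) : Set (EuclideanSpace ℝ (Fin n)) :=
  {x | x ≠ 0 ∧ ‖x‖⁻¹ • x ∈ S}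

/-- The canonical surface measure `dσ` on the unit sphere of `ℝⁿ`, as a measure on `ℝⁿ`. -/
def sphMeasure (n : ℕ) : Measure (EuclideanSpace ℝ (Fin n)) :=
  Measure.map Subtype.val
    ((volume : Measure (EuclideanSpace ℝ (Fin n))).toSphere)

/-- A (Dirichlet) eigenfunction of the Laplace–Beltrami operator on `S ⊆ 𝕊^{n-1}`
relative to the eigenvalue `lam`. -/
def IsEigenfun {n : ℕ} (S : Set (EuclideanSpace ℝ (Fin n))) (lam : ℝ)
    (φ : EuclideanSpace ℝ (Fin n) → ℝ) : Prop :=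
  ContinuousOn (fun x => φ (‖x‖⁻¹ • x)) (coneOf (closure S)) ∧
  ContDiffOn ℝ 2 (fun x => φ (‖x‖⁻¹ • x)) (coneOf S) ∧
  (∀ σ ∈ closure S \ S, φ σ = 0) ∧
  (∃ σ ∈ S, φ σ ≠ 0) ∧
  (∀ σ ∈ S, - sphLap φ σ = lam * φ σ)

/-- The Dirichlet spectrum `Λ(Σ)` of the Laplace–Beltrami operator on `S`. -/
def spec {n : ℕ} (S : Set (EuclideanSpace ℝ (Fin n))) : Set ℝ :=
  {lam | ∃ φ, IsEigenfun S lam φ}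

/-- `S` is a domain in the unit sphere `𝕊^{n-1}`: a relatively open connected
nonempty subset. -/
def IsSphDomain {n : ℕ} (S : Set (EuclideanSpace ℝ (Fin n))) : Prop :=
  S ⊆ Metric.sphere (0 : EuclideanSpace ℝ (Fin n)) 1 ∧
  IsOpen (Subtype.val ⁻¹' S : Set (Metric.sphere (0 : EuclideanSpace ℝ (Fin n)) 1)) ∧
  IsConnected S

/-- `S` is a domain of class `C²` in the unit sphere: a domain such that the cone
over it admits local `C²` defining functions away from the origin. -/
def IsC2SphDomain {n : ℕ} (S : Set (EuclideanSpace ℝ (Fin n))) : Prop :=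
  IsSphDomain S ∧
  ∀ x ∈ frontier (coneOf S) \ {0}, ∃ (U : Set (EuclideanSpace ℝ (Fin n)))
    (f : EuclideanSpace ℝ (Fin n) → ℝ), IsOpen U ∧ x ∈ U ∧ ContDiff ℝ 2 f ∧
    fderiv ℝ f x ≠ 0 ∧ coneOf S ∩ U = {y ∈ U | f y < 0}

/-- `γ_{n,α} = ((n-2)/2)² - ((α-2)/2)²`. -/
def gam (n : ℕ) (α : ℝ) : ℝ := (((n : ℝ) - 2) / 2) ^ 2 - ((α - 2) / 2) ^ 2

/-- `γ̄_{n,α} = ((n-2)/2)² + ((α-2)/2)²`. -/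
def gbar (n : ℕ) (α : ℝ) : ℝ := (((n : ℝ) - 2) / 2) ^ 2 + ((α - 2) / 2) ^ 2

/-- The class `C²_c(Ω̄ ∖ {0})` of Navier test functions: `C²` up to the closure of
`Ω`, vanishing on `∂Ω` and in a neighborhood of `0` and of `∞`. -/
def NavierAdm {n : ℕ} (Ω : Set (EuclideanSpace ℝ (Fin n)))
    (u : EuclideanSpace ℝ (Fin n) → ℝ) : Prop :=
  ContDiffOn ℝ 2 u (closure Ω) ∧
  (∀ x ∈ frontier Ω, u x = 0) ∧
  (∃ ε > 0, ∀ x : EuclideanSpace ℝ (Fin n), ‖x‖ < ε → u x = 0) ∧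
  (∃ R : ℝ, ∀ x : EuclideanSpace ℝ (Fin n), R < ‖x‖ → u x = 0)

/-- The class `C²_c(Ω)` of Dirichlet test functions: globally `C²` with compact
support contained in `Ω`. -/
def DirichletAdm {n : ℕ} (Ω : Set (EuclideanSpace ℝ (Fin n)))
    (u : EuclideanSpace ℝ (Fin n) → ℝ) : Prop :=
  ContDiff ℝ 2 u ∧ HasCompactSupport u ∧ tsupport u ⊆ Ω

/-- The best Rellich constant `μ_N(Ω;α)` under Navier boundary conditions. -/
def muN {n : ℕ} (Ω : Set (EuclideanSpace ℝ (Fin n))) (α : ℝ) : ℝ :=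
  sInf {q : ℝ | ∃ u, NavierAdm Ω u ∧ (∃ x ∈ Ω, u x ≠ 0) ∧
    q = (∫ x in Ω, ‖x‖ ^ α * (lap u x) ^ 2) / (∫ x in Ω, ‖x‖ ^ (α - 4) * (u x) ^ 2)}

/-- The best Rellich constant `μ_D(Ω;α)` under Dirichlet boundary conditions. -/
def muD {n : ℕ} (Ω : Set (EuclideanSpace ℝ (Fin n))) (α : ℝ) : ℝ :=
  sInf {q : ℝ | ∃ u, DirichletAdm Ω u ∧ (∃ x ∈ Ω, u x ≠ 0) ∧
    q = (∫ x in Ω, ‖x‖ ^ α * (lap u x) ^ 2) / (∫ x in Ω, ‖x‖ ^ (α - 4) * (u x) ^ 2)}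

/-- The surrogate of `H² ∩ H¹₀(Σ)`: functions whose `0`-homogeneous extension is
`C²` up to the closure of the cone, vanishing on the relative boundary of `S`. -/
def NavAdmS {n : ℕ} (S : Set (EuclideanSpace ℝ (Fin n)))
    (φ : EuclideanSpace ℝ (Fin n) → ℝ) : Prop :=
  ContDiffOn ℝ 2 (fun x => φ (‖x‖⁻¹ • x)) (coneOf (closure S)) ∧
  (∀ σ ∈ closure S \ S, φ σ = 0)

/-- The surrogate of `H²₀(Σ)`: as `NavAdmS`, with in addition vanishing gradient
on the relative boundary of `S`. -/
def DirAdmS {n : ℕ} (S : Set (EuclideanSpace ℝ (Fin n)))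
    (φ : EuclideanSpace ℝ (Fin n) → ℝ) : Prop :=
  NavAdmS S φ ∧
  ∀ σ ∈ closure S \ S,
    fderivWithin ℝ (fun x => φ (‖x‖⁻¹ • x)) (coneOf (closure S)) σ = 0

/-- The Rayleigh-type quotient `∫_Σ |Lφ|² dσ / ∫_Σ |φ|² dσ` with
`Lφ = -Δ_σ φ + γ φ`. -/
def sphQuot {n : ℕ} (S : Set (EuclideanSpace ℝ (Fin n))) (γ : ℝ)
    (φ : EuclideanSpace ℝ (Fin n) → ℝ) : ℝ :=
  (∫ σ in S, (- sphLap φ σ + γ * φ σ) ^ 2 ∂(sphMeasure n)) /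
    (∫ σ in S, (φ σ) ^ 2 ∂(sphMeasure n))

/-- Partial derivative `w_s` of a function on the cylinder `ℝ × 𝕊^{n-1}`. -/
def ws {n : ℕ} (w : ℝ × EuclideanSpace ℝ (Fin n) → ℝ)
    (p : ℝ × EuclideanSpace ℝ (Fin n)) : ℝ :=
  deriv (fun t => w (t, p.2)) p.1

/-- Second partial derivative `w_ss` of a function on the cylinder. -/
def wss {n : ℕ} (w : ℝ × EuclideanSpace ℝ (Fin n) → ℝ)
    (p : ℝ × EuclideanSpace ℝ (Fin n)) : ℝ :=
  deriv (fun t => ws w (t, p.2)) p.1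

end

noncomputable section

/-- The open arc of `𝕊¹` of length `2θ` centered at the angle `c`. -/
def arcSet (c θ : ℝ) : Set (EuclideanSpace ℝ (Fin 2)) :=
  {x | ∃ t : ℝ, |t - c| < θ ∧ x 0 = Real.cos t ∧ x 1 = Real.sin t}



/-- Sine coefficient of `f` on `[0, ℓ]`. -/
def sinCoef (ℓ : ℝ) (f : ℝ → ℝ) (j : ℕ) : ℝ :=
  ∫ x in (0:ℝ)..ℓ, f x * Real.sin ((j + 1) * Real.pi / ℓ * x)

def oddExt (f : ℝ → ℝ) (x : ℝ) : ℝ := if x < 0 then - f (-x) else f x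

lemma integral_sym_split (ℓ : ℝ) (hl : 0 < ℓ) (g : ℝ → ℂ)
    (h1 : IntervalIntegrable g volume (-ℓ) 0) (h2 : IntervalIntegrable g volume 0 ℓ) :
    ∫ x in (-ℓ)..ℓ, g x = ∫ x in (0:ℝ)..ℓ, (g x + g (-x)) := by
  rw [← intervalIntegral.integral_add_adjacent_intervals h1 h2]
  have h3 : IntervalIntegrable (fun x => g (-x)) volume 0 ℓ := by
    have := (IntervalIntegrable.iff_comp_neg (f := g) (a := -ℓ) (b := 0)).1 h1
    simpa using this.symm
  rw [intervalIntegral.integral_add h2 h3, intervalIntegral.integral_comp_neg]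
  simp [add_comm]

lemma oddExt_measurable (f : ℝ → ℝ) (hf : Continuous f) : Measurable (oddExt f) := by
  unfold oddExt
  exact Measurable.ite measurableSet_Iio (by fun_prop) (by fun_prop)

lemma oddExt_bdd (ℓ : ℝ) (hl : 0 < ℓ) (f : ℝ → ℝ) (hf : Continuous f) :
    ∃ C, ∀ x ∈ Icc (-ℓ) ℓ, |oddExt f x| ≤ C := by
  obtain ⟨C, hC⟩ := (isCompact_Icc (a := -ℓ) (b := ℓ)).exists_bound_of_continuousOn hf.continuousOn
  refine ⟨C, fun x hx => ?_⟩
  unfold oddExt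
  split_ifs
  · rw [abs_neg]; exact hC (-x) ⟨by linarith [hx.2], by linarith [hx.1]⟩
  · exact hC x hx

lemma intervalIntegrable_bdd (a b : ℝ) (g : ℝ → ℂ) (hg : Measurable g) (C : ℝ)
    (hC : ∀ x ∈ uIcc a b, ‖g x‖ ≤ C) : IntervalIntegrable g volume a b := by
  rw [intervalIntegrable_iff]
  refine Measure.integrableOn_of_bounded (M := C) (by simp) hg.aestronglyMeasurable ?_
  filter_upwards [ae_restrict_mem measurableSet_uIoc] with x hx
  exact hC x (uIoc_subset_uIcc hx)

lemma fourierCoeffOn_oddExt (ℓ : ℝ) (hl : 0 < ℓ) (f : ℝ → ℝ) (hf : Continuous f) (n : ℤ) :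
    fourierCoeffOn (show (-ℓ) < ℓ by linarith) (fun x => (oddExt f x : ℂ)) n =
      - (Complex.I / ℓ) * ((∫ x in (0:ℝ)..ℓ, f x * Real.sin (n * Real.pi / ℓ * x) : ℝ) : ℂ) := by
  rw [fourierCoeffOn_eq_integral]
  obtain ⟨C, hC⟩ := oddExt_bdd ℓ hl f hf
  have hmeas : Measurable (fun x : ℝ => fourier (-n) (x : AddCircle (ℓ - -ℓ)) • (oddExt f x : ℂ)) := by
    have h1 : Measurable (fun x : ℝ => fourier (-n) (x : AddCircle (ℓ - -ℓ))) := by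
      apply Continuous.measurable
      exact (fourier (-n)).continuous.comp (AddCircle.continuous_mk' _)
    exact h1.smul (Complex.measurable_ofReal.comp (oddExt_measurable f hf))
  have hb : ∀ x ∈ Icc (-ℓ) ℓ, ‖fourier (-n) (x : AddCircle (ℓ - -ℓ)) • (oddExt f x : ℂ)‖ ≤ C := by
    intro x hx
    rw [norm_smul]
    have : ‖fourier (-n) (x : AddCircle (ℓ - -ℓ))‖ = 1 := by
      rw [fourier_apply]; exact Circle.norm_coe _
    rw [this, one_mul, Complex.norm_real]
    exact hC x hx
  rw [integral_sym_split ℓ hl]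
  · have key : ∀ x ∈ Ioo 0 ℓ, (fourier (-n) (x : AddCircle (ℓ - -ℓ)) • (oddExt f x : ℂ)
        + fourier (-n) ((-x : ℝ) : AddCircle (ℓ - -ℓ)) • (oddExt f (-x) : ℂ)) =
        -2 * Complex.I * ((f x * Real.sin (n * Real.pi / ℓ * x) : ℝ) : ℂ) := by
      intro x hx
      have e1 : oddExt f x = f x := by unfold oddExt; rw [if_neg (by linarith [hx.1])]
      have e2 : oddExt f (-x) = - f x := by
        unfold oddExt; rw [if_pos (by linarith [hx.1]), neg_neg]
      rw [e1, e2, fourier_coe_apply, fourier_coe_apply]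
      have hl' : (ℓ : ℂ) ≠ 0 := by exact_mod_cast hl.ne'
      have a1 : 2 * (Real.pi:ℂ) * Complex.I * ((-n : ℤ):ℂ) * (x:ℂ) / ((ℓ - -ℓ : ℝ):ℂ)
          = -((n * Real.pi / ℓ * x : ℝ):ℂ) * Complex.I := by
        push_cast; field_simp; ring
      have a2 : 2 * (Real.pi:ℂ) * Complex.I * ((-n : ℤ):ℂ) * ((-x:ℝ):ℂ) / ((ℓ - -ℓ : ℝ):ℂ)
          = ((n * Real.pi / ℓ * x : ℝ):ℂ) * Complex.I := by
        push_cast; field_simp; ring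
      rw [a1, a2]
      have hs := Complex.sin.eq_1 ((n * Real.pi / ℓ * x : ℝ):ℂ)
      push_cast at hs ⊢
      rw [hs]
      simp only [smul_eq_mul]
      ring_nf
      simp only [Complex.I_sq]
      ring
    rw [intervalIntegral.integral_congr_ae (g := fun x =>
      -2 * Complex.I * ((f x * Real.sin (n * Real.pi / ℓ * x) : ℝ) : ℂ))]
    · rw [intervalIntegral.integral_const_mul, intervalIntegral.integral_ofReal]
      have hl' : (ℓ : ℂ) ≠ 0 := by exact_mod_cast hl.ne'
      rw [Complex.real_smul]
      push_cast
      field_simp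
      ring
    · have : ∀ᵐ x : ℝ, x ≠ ℓ := by simp [ae_iff]
      filter_upwards [this] with x hx hx'
      rw [uIoc_of_le hl.le] at hx'
      exact key x ⟨hx'.1, lt_of_le_of_ne hx'.2 hx⟩
  · exact intervalIntegrable_bdd _ _ _ hmeas C (fun x hx => hb x (by
      rw [uIcc_of_le (by linarith)] at hx; exact ⟨hx.1, by linarith [hx.2]⟩))
  · exact intervalIntegrable_bdd _ _ _ hmeas C (fun x hx => hb x (by
      rw [uIcc_of_le (by linarith)] at hx; exact ⟨by linarith [hx.1], hx.2⟩))

lemma sine_parseval (ℓ : ℝ) (hl : 0 < ℓ) (f : ℝ → ℝ) (hf : Continuous f) :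
    HasSum (fun j : ℕ => (2 / ℓ) * (sinCoef ℓ f j) ^ 2) (∫ x in (0:ℝ)..ℓ, (f x) ^ 2) := by
  obtain ⟨C, hC⟩ := oddExt_bdd ℓ hl f hf
  have hmeas : Measurable (fun x => (oddExt f x : ℂ)) :=
    Complex.measurable_ofReal.comp (oddExt_measurable f hf)
  have hL2 : MemLp (fun x => (oddExt f x : ℂ)) 2 (volume.restrict (Ioc (-ℓ) ℓ)) := by
    refine MemLp.of_bound hmeas.aestronglyMeasurable C ?_
    filter_upwards [ae_restrict_mem measurableSet_Ioc] with x hx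
    rw [Complex.norm_real]
    exact hC x ⟨hx.1.le, hx.2⟩
  have H := hasSum_sq_fourierCoeffOn (show (-ℓ) < ℓ by linarith) hL2
  have hI : ∫ x in (-ℓ)..ℓ, ‖(oddExt f x : ℂ)‖ ^ 2 = 2 * ∫ x in (0:ℝ)..ℓ, (f x) ^ 2 := by
    have e : ∀ x, ‖(oddExt f x : ℂ)‖ ^ 2 = (oddExt f x)^2 := by
      intro x; rw [Complex.norm_real, Real.norm_eq_abs, sq_abs]
    simp_rw [e]
    have hb : ∀ x ∈ Icc (-ℓ) ℓ, ‖((oddExt f x ^2 : ℝ) : ℂ)‖ ≤ C ^ 2 := by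
      intro x hx
      rw [Complex.norm_real, Real.norm_eq_abs, abs_pow]
      exact pow_le_pow_left₀ (abs_nonneg _) (hC x hx) 2
    have hm2 : Measurable (fun x => ((oddExt f x ^2 : ℝ) : ℂ)) :=
      Complex.measurable_ofReal.comp ((oddExt_measurable f hf).pow_const 2)
    have := integral_sym_split ℓ hl (fun x => ((oddExt f x ^2 : ℝ) : ℂ))
      (intervalIntegrable_bdd _ _ _ hm2 (C^2) (fun x hx => hb x (by
        rw [uIcc_of_le (by linarith)] at hx; exact ⟨hx.1, by linarith [hx.2]⟩)))
      (intervalIntegrable_bdd _ _ _ hm2 (C^2) (fun x hx => hb x (by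
        rw [uIcc_of_le (by linarith)] at hx; exact ⟨by linarith [hx.1], hx.2⟩)))
    have e2 : ∫ x in (0:ℝ)..ℓ, (((oddExt f x ^2 : ℝ) : ℂ) + ((oddExt f (-x) ^2 : ℝ) : ℂ)) =
        ∫ x in (0:ℝ)..ℓ, ((2 * f x ^ 2 : ℝ) : ℂ) := by
      apply intervalIntegral.integral_congr_ae
      refine ae_of_all _ fun x hx => ?_
      rw [uIoc_of_le hl.le] at hx
      have e1 : oddExt f x = f x := by unfold oddExt; rw [if_neg (by linarith [hx.1])]
      have e2 : oddExt f (-x) = - f x := by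
        unfold oddExt; rw [if_pos (by linarith [hx.1]), neg_neg]
      rw [e1, e2]; push_cast; ring
    rw [e2, intervalIntegral.integral_ofReal, intervalIntegral.integral_ofReal,
      intervalIntegral.integral_const_mul] at this
    exact_mod_cast this
  rw [hI] at H
  have hc : ∀ n : ℤ, ‖fourierCoeffOn (show (-ℓ) < ℓ by linarith) (fun x => (oddExt f x : ℂ)) n‖ ^ 2
      = (1 / ℓ ^ 2) * (∫ x in (0:ℝ)..ℓ, f x * Real.sin (n * Real.pi / ℓ * x)) ^ 2 := by
    intro n
    rw [fourierCoeffOn_oddExt ℓ hl f hf n, norm_mul, norm_neg, norm_div, Complex.norm_I,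
      Complex.norm_real, Complex.norm_real, mul_pow, Real.norm_eq_abs, Real.norm_eq_abs, sq_abs,
      div_pow, sq_abs, one_pow]
  simp_rw [hc] at H
  have H2 := H.nat_add_neg
  have H3 := (hasSum_nat_add_iff' 1).2 H2
  have H4 := H3.mul_left ℓ
  convert! H4 using 1
  · ext j
    unfold sinCoef
    have e : ∫ x in (0:ℝ)..ℓ, f x * Real.sin (((-((j + 1 : ℕ) : ℤ) : ℤ) : ℝ) * Real.pi / ℓ * x)
        = - ∫ x in (0:ℝ)..ℓ, f x * Real.sin ((j + 1) * Real.pi / ℓ * x) := by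
      rw [← intervalIntegral.integral_neg]
      congr 1; ext x
      rw [← mul_neg, ← Real.sin_neg]
      congr 2; push_cast; ring
    rw [e]
    push_cast
    field_simp
    ring
  · simp
    field_simp
    ring


/-- The `j`-th Dirichlet eigenvalue on an interval of length `ℓ`. -/
def lamE (ℓ : ℝ) (j : ℕ) : ℝ := ((j + 1) * Real.pi / ℓ) ^ 2

/-- `C²` function on `[0, ℓ]`, with continuous extensions of the derivatives. -/
structure IntervalC2 (ℓ : ℝ) (f f1 f2 : ℝ → ℝ) : Prop where
  c0 : Continuous f
  c1 : Continuous f1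
  c2 : Continuous f2
  d1 : ∀ x ∈ Ioo 0 ℓ, HasDerivAt f (f1 x) x
  d2 : ∀ x ∈ Ioo 0 ℓ, HasDerivAt f1 (f2 x) x
  z0 : f 0 = 0
  zl : f ℓ = 0

lemma integral_ftc (ℓ : ℝ) (hl : 0 < ℓ) (G g : ℝ → ℝ) (hG : Continuous G) (hg : Continuous g)
    (h : ∀ x ∈ Ioo 0 ℓ, HasDerivAt G (g x) x) : ∫ x in (0:ℝ)..ℓ, g x = G ℓ - G 0 :=
  intervalIntegral.integral_eq_sub_of_hasDerivAt_of_le hl.le hG.continuousOn h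
    (hg.intervalIntegrable _ _)

lemma hasDerivAt_sin_mul (k x : ℝ) :
    HasDerivAt (fun x => Real.sin (k * x)) (k * Real.cos (k * x)) x := by
  have := (Real.hasDerivAt_sin (k * x)).comp x ((hasDerivAt_id x).const_mul k)
  simpa [Function.comp_def, mul_comm] using this

lemma hasDerivAt_cos_mul (k x : ℝ) :
    HasDerivAt (fun x => Real.cos (k * x)) (- (k * Real.sin (k * x))) x := by
  have := (Real.hasDerivAt_cos (k * x)).comp x ((hasDerivAt_id x).const_mul k)
  simpa [Function.comp_def, mul_comm] using this

lemma sin_end (ℓ : ℝ) (hl : 0 < ℓ) (j : ℕ) : Real.sin ((j + 1) * Real.pi / ℓ * ℓ) = 0 := by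
  rw [div_mul_cancel₀ _ hl.ne']
  exact_mod_cast Real.sin_nat_mul_pi (j + 1)

lemma sinCoef_deriv2 (ℓ : ℝ) (hl : 0 < ℓ) (f f1 f2 : ℝ → ℝ) (h : IntervalC2 ℓ f f1 f2) (j : ℕ) :
    sinCoef ℓ f2 j = - lamE ℓ j * sinCoef ℓ f j := by
  have := h.c0; have := h.c1; have := h.c2
  set k : ℝ := (j + 1) * Real.pi / ℓ with hk
  have key := integral_ftc ℓ hl
    (fun x => f1 x * Real.sin (k * x) - k * (f x * Real.cos (k * x)))
    (fun x => f2 x * Real.sin (k * x) + k ^ 2 * (f x * Real.sin (k * x)))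
    (by fun_prop) (by fun_prop) (by
      intro x hx
      have := ((h.d2 x hx).mul (hasDerivAt_sin_mul k x)).sub
        (((h.d1 x hx).mul (hasDerivAt_cos_mul k x)).const_mul k)
      convert! this using 1
      ring)
  rw [intervalIntegral.integral_add (Continuous.intervalIntegrable (by fun_prop) _ _)
    (Continuous.intervalIntegrable (by fun_prop) _ _), intervalIntegral.integral_const_mul] at key
  have hs : Real.sin (k * ℓ) = 0 := sin_end ℓ hl j
  simp only [hs, h.z0, h.zl, mul_zero, Real.sin_zero, zero_mul, sub_zero] at key
  unfold sinCoef lamE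
  rw [← hk]
  linarith

lemma sinCoef_add (ℓ : ℝ) (f g : ℝ → ℝ) (hf : Continuous f) (hg : Continuous g) (j : ℕ) :
    sinCoef ℓ (fun x => f x + g x) j = sinCoef ℓ f j + sinCoef ℓ g j := by
  unfold sinCoef
  rw [← intervalIntegral.integral_add (Continuous.intervalIntegrable (by fun_prop) _ _)
    (Continuous.intervalIntegrable (by fun_prop) _ _)]
  simp_rw [add_mul]

lemma navier_hasSum (ℓ : ℝ) (hl : 0 < ℓ) (f f1 f2 : ℝ → ℝ) (h : IntervalC2 ℓ f f1 f2) :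
    HasSum (fun j : ℕ => (1 - lamE ℓ j) ^ 2 * ((2 / ℓ) * (sinCoef ℓ f j) ^ 2))
      (∫ x in (0:ℝ)..ℓ, (f2 x + f x) ^ 2) := by
  have := sine_parseval ℓ hl (fun x => f2 x + f x) (h.c2.add h.c0)
  convert! this using 1
  ext j
  rw [sinCoef_add ℓ _ _ h.c2 h.c0, sinCoef_deriv2 ℓ hl f f1 f2 h]
  ring

lemma navier_1d (ℓ : ℝ) (hl : 0 < ℓ) (μ : ℝ) (hμ : ∀ j, μ ≤ (1 - lamE ℓ j) ^ 2)
    (f f1 f2 : ℝ → ℝ) (h : IntervalC2 ℓ f f1 f2) :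
    μ * ∫ x in (0:ℝ)..ℓ, (f x) ^ 2 ≤ ∫ x in (0:ℝ)..ℓ, (f2 x + f x) ^ 2 := by
  refine hasSum_le (fun j => ?_) ((sine_parseval ℓ hl f h.c0).mul_left μ)
    (navier_hasSum ℓ hl f f1 f2 h)
  exact mul_le_mul_of_nonneg_right (hμ j) (by positivity)

lemma g_sq_integral (ℓ : ℝ) (hl : 0 < ℓ) (d0 d1 : ℝ) :
    ∫ x in (0:ℝ)..ℓ, (d0 * (Real.sin (Real.pi / ℓ * x) - 2 / Real.pi) +
      d1 * (Real.sin (2 * Real.pi / ℓ * x) + 6 / (Real.pi * ℓ) * (x - ℓ / 2))) ^ 2 =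
      d0 ^ 2 * (ℓ / 2 - 4 * ℓ / Real.pi ^ 2) + d1 ^ 2 * (ℓ / 2 - 3 * ℓ / Real.pi ^ 2) := by
  have hpi := Real.pi_pos
  set a : ℝ := Real.pi / ℓ with ha
  have ha0 : a ≠ 0 := by positivity
  have hb : 2 * Real.pi / ℓ = 2 * a := by rw [ha]; ring
  rw [hb]
  set A : ℝ := - (2 * d0 / Real.pi) with hA
  set B : ℝ := 6 * d1 / (Real.pi * ℓ) with hB
  have key := integral_ftc ℓ hl
    (fun x => d0 ^ 2 / 2 * x - d0 ^ 2 / (2 * a) * (Real.sin (a * x) * Real.cos (a * x))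
      + 4 / 3 * d0 * d1 / a * (Real.sin (a * x) ^ 3)
      + d1 ^ 2 / 2 * x - d1 ^ 2 / (4 * a) * (Real.sin (2 * a * x) * Real.cos (2 * a * x))
      - 2 * d0 * A / a * Real.cos (a * x)
      - 2 * d0 * B / a * ((x - ℓ / 2) * Real.cos (a * x)) + 2 * d0 * B / a ^ 2 * Real.sin (a * x)
      - d1 * A / a * Real.cos (2 * a * x)
      - d1 * B / a * ((x - ℓ / 2) * Real.cos (2 * a * x))
      + d1 * B / (2 * a ^ 2) * Real.sin (2 * a * x)
      + A ^ 2 * (x - ℓ / 2) + A * B * (x - ℓ / 2) ^ 2 + B ^ 2 / 3 * (x - ℓ / 2) ^ 3)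
    (fun x => (d0 * (Real.sin (a * x) - 2 / Real.pi) +
      d1 * (Real.sin (2 * a * x) + 6 / (Real.pi * ℓ) * (x - ℓ / 2))) ^ 2)
    (by fun_prop) (by fun_prop) (by
      intro x hx
      have hy : HasDerivAt (fun x : ℝ => x - ℓ / 2) 1 x := (hasDerivAt_id x).sub_const _
      have hx1 : HasDerivAt (fun x : ℝ => x) 1 x := hasDerivAt_id x
      have s1 := hasDerivAt_sin_mul a x
      have c1 := hasDerivAt_cos_mul a x
      have s2 := hasDerivAt_sin_mul (2 * a) x
      have c2 := hasDerivAt_cos_mul (2 * a) x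
      have := ((((((((((((hx1.const_mul (d0 ^ 2 / 2)).sub
        ((s1.mul c1).const_mul (d0 ^ 2 / (2 * a)))).add
        ((s1.pow 3).const_mul (4 / 3 * d0 * d1 / a))).add
        (hx1.const_mul (d1 ^ 2 / 2))).sub
        ((s2.mul c2).const_mul (d1 ^ 2 / (4 * a)))).sub
        (c1.const_mul (2 * d0 * A / a))).sub
        ((hy.mul c1).const_mul (2 * d0 * B / a))).add
        (s1.const_mul (2 * d0 * B / a ^ 2))).sub
        (c2.const_mul (d1 * A / a))).sub
        ((hy.mul c2).const_mul (d1 * B / a))).add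
        (s2.const_mul (d1 * B / (2 * a ^ 2)))).add
        ((hy.const_mul (A ^ 2)).add (((hy.pow 2).const_mul (A * B)).add
        ((hy.pow 3).const_mul (B ^ 2 / 3)))))
      convert! this using 1
      · ext y; simp; ring
      · have e1 : d0 * (Real.sin (a * x) - 2 / Real.pi) = d0 * Real.sin (a * x) + A := by
          rw [hA]; ring
        have e2 : d1 * (Real.sin (2 * a * x) + 6 / (Real.pi * ℓ) * (x - ℓ / 2)) =
          d1 * Real.sin (2 * a * x) + B * (x - ℓ / 2) := by
          rw [hB]; ring
        rw [e1, e2]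
        have e3 : Real.sin (2 * a * x) = 2 * Real.sin (a * x) * Real.cos (a * x) := by
          rw [mul_assoc, Real.sin_two_mul]
        have p1 := Real.sin_sq_add_cos_sq (a * x)
        have p2 := Real.sin_sq_add_cos_sq (2 * a * x)
        have c1e : Real.cos (a * x) ^ 2 = 1 - Real.sin (a * x) ^ 2 := by linarith
        have c2e : Real.cos (2 * a * x) ^ 2 = 1 - Real.sin (2 * a * x) ^ 2 := by linarith
        simp only [Pi.mul_apply, Nat.cast_ofNat]
        field_simp
        ring_nf
        simp only [c1e, c2e]
        ring_nf
        have e4 : Real.sin (a * x * 2) = 2 * Real.sin (a * x) * Real.cos (a * x) := by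
          rw [← e3]; ring_nf
        have e5 : Real.cos (a * x * 2) ^ 2 = 1 - Real.sin (a * x * 2) ^ 2 := by
          rw [show a * x * 2 = 2 * a * x by ring]; exact c2e
        simp only [e5]
        ring_nf
        simp only [e4]
        ring_nf)
  rw [key]
  have q1 : a * ℓ = Real.pi := by rw [ha]; field_simp
  have q2 : 2 * a * ℓ = 2 * Real.pi := by rw [mul_assoc, q1]
  simp only [q1, q2, Real.sin_pi, Real.cos_pi, Real.sin_two_pi, Real.cos_two_pi, mul_zero,
    Real.sin_zero, Real.cos_zero]
  rw [hA, hB, ha]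
  field_simp
  ring


lemma dirichlet_low (ℓ : ℝ) (hl : 0 < ℓ) (f f1 f2 : ℝ → ℝ) (h : IntervalC2 ℓ f f1 f2)
    (y0 : f1 0 = 0) (yl : f1 ℓ = 0) :
    (1 + 6 / Real.pi ^ 2) * ((2 / ℓ) * (sinCoef ℓ f2 0) ^ 2 + (2 / ℓ) * (sinCoef ℓ f2 1) ^ 2) ≤
      ∫ x in (0:ℝ)..ℓ, (f2 x) ^ 2 := by
  have hc0 := h.c0; have hc1 := h.c1; have hc2 := h.c2
  have hpi := Real.pi_pos
  set b0 := sinCoef ℓ f2 0 with hb0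
  set b1 := sinCoef ℓ f2 1 with hb1
  set d0 := 2 / ℓ * b0 with hd0
  set d1 := 2 / ℓ * b1 with hd1
  set g : ℝ → ℝ := fun x => (d0 * (Real.sin (Real.pi / ℓ * x) - 2 / Real.pi) +
      d1 * (Real.sin (2 * Real.pi / ℓ * x) + 6 / (Real.pi * ℓ) * (x - ℓ / 2))) with hg
  have hgc : Continuous g := by rw [hg]; fun_prop
  have hgi := g_sq_integral ℓ hl d0 d1
  have hgi' : ∫ x in (0:ℝ)..ℓ, (g x) ^ 2 = _ := hgi
  -- the linear functional
  have hlin : ∫ x in (0:ℝ)..ℓ, f2 x * g x = d0 * b0 + d1 * b1 := by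
    set A : ℝ := - (2 * d0 / Real.pi) with hA
    set B : ℝ := 6 * d1 / (Real.pi * ℓ) with hB
    have key := integral_ftc ℓ hl (fun x => f1 x * (A + B * (x - ℓ / 2)) - B * f x)
      (fun x => f2 x * (A + B * (x - ℓ / 2))) (by fun_prop) (by fun_prop) (by
        intro x hx
        have hy : HasDerivAt (fun x : ℝ => A + B * (x - ℓ / 2)) B x := by
          have := (((hasDerivAt_id x).sub_const (ℓ / 2)).const_mul B).const_add A
          simpa using this
        have := ((h.d2 x hx).mul hy).sub ((h.d1 x hx).const_mul B)
        convert! this using 1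
        ring)
    simp only [y0, yl, h.z0, h.zl] at key
    have e : ∀ x, f2 x * g x = d0 * (f2 x * Real.sin (((0:ℕ) + 1) * Real.pi / ℓ * x)) +
        d1 * (f2 x * Real.sin (((1:ℕ) + 1) * Real.pi / ℓ * x)) + f2 x * (A + B * (x - ℓ / 2)) := by
      intro x
      rw [hg, hA, hB]
      have e1 : (((0:ℕ):ℝ) + 1) * Real.pi / ℓ * x = Real.pi / ℓ * x := by push_cast; ring
      have e2 : (((1:ℕ):ℝ) + 1) * Real.pi / ℓ * x = 2 * Real.pi / ℓ * x := by push_cast; ring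
      rw [e1, e2]
      ring
    simp_rw [e]
    rw [intervalIntegral.integral_add (Continuous.intervalIntegrable (by fun_prop) _ _)
      (Continuous.intervalIntegrable (by fun_prop) _ _), key,
      intervalIntegral.integral_add (Continuous.intervalIntegrable (by fun_prop) _ _)
      (Continuous.intervalIntegrable (by fun_prop) _ _), intervalIntegral.integral_const_mul,
      intervalIntegral.integral_const_mul]
    rw [hb0, hb1]
    unfold sinCoef
    ring
  have hnn : 0 ≤ ∫ x in (0:ℝ)..ℓ, (f2 x - g x) ^ 2 :=
    intervalIntegral.integral_nonneg hl.le (fun x _ => sq_nonneg _)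
  have hexp : ∫ x in (0:ℝ)..ℓ, (f2 x - g x) ^ 2 = (∫ x in (0:ℝ)..ℓ, (f2 x) ^ 2)
      - 2 * (∫ x in (0:ℝ)..ℓ, f2 x * g x) + ∫ x in (0:ℝ)..ℓ, (g x) ^ 2 := by
    rw [← intervalIntegral.integral_const_mul, ← intervalIntegral.integral_sub
      (Continuous.intervalIntegrable (by fun_prop) _ _)
      (Continuous.intervalIntegrable (by fun_prop) _ _), ← intervalIntegral.integral_add
      (Continuous.intervalIntegrable (by fun_prop) _ _)
      (Continuous.intervalIntegrable (by fun_prop) _ _)]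
    congr 1; ext x; ring
  rw [hexp, hlin, hgi'] at hnn
  have r0 : b0 = ℓ / 2 * d0 := by rw [hd0]; field_simp
  have r1 : b1 = ℓ / 2 * d1 := by rw [hd1]; field_simp
  rw [r0, r1] at hnn
  have e0 : 2 / ℓ * b0 ^ 2 = ℓ / 2 * d0 ^ 2 := by rw [r0]; field_simp
  have e1 : 2 / ℓ * b1 ^ 2 = ℓ / 2 * d1 ^ 2 := by rw [r1]; field_simp
  rw [e0, e1]
  have hx : 0 ≤ ℓ / Real.pi ^ 2 * d0 ^ 2 := by positivity
  have i1 : (1 + 6 / Real.pi ^ 2) * (ℓ / 2 * d0 ^ 2 + ℓ / 2 * d1 ^ 2) =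
    ℓ / 2 * d0 ^ 2 + ℓ / 2 * d1 ^ 2 + 3 * (ℓ / Real.pi ^ 2 * d0 ^ 2) +
      3 * (ℓ / Real.pi ^ 2 * d1 ^ 2) := by ring
  have i2 : d0 ^ 2 * (ℓ / 2 - 4 * ℓ / Real.pi ^ 2) + d1 ^ 2 * (ℓ / 2 - 3 * ℓ / Real.pi ^ 2) =
    ℓ / 2 * d0 ^ 2 + ℓ / 2 * d1 ^ 2 - 4 * (ℓ / Real.pi ^ 2 * d0 ^ 2) -
      3 * (ℓ / Real.pi ^ 2 * d1 ^ 2) := by ring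
  rw [i1]
  rw [i2] at hnn
  linarith

lemma dirichlet_1d (ℓ : ℝ) (hl : 0 < ℓ) (hℓ : (Real.pi / ℓ) ^ 2 = 2 / 5)
    (f f1 f2 : ℝ → ℝ) (h : IntervalC2 ℓ f f1 f2) (y0 : f1 0 = 0) (yl : f1 ℓ = 0) :
    (9 / 25 + 2 / 125) * ∫ x in (0:ℝ)..ℓ, (f x) ^ 2 ≤ ∫ x in (0:ℝ)..ℓ, (f2 x + f x) ^ 2 := by
  have hpi := Real.pi_pos
  have hlam : ∀ j : ℕ, lamE ℓ j = 2 / 5 * (j + 1) ^ 2 := by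
    intro j; unfold lamE
    rw [mul_div_assoc, mul_pow, hℓ]; ring
  set D := ∫ x in (0:ℝ)..ℓ, (f2 x) ^ 2 with hD
  set q : ℕ → ℝ := fun j => (2 / ℓ) * (sinCoef ℓ f2 j) ^ 2 with hq
  set p : ℕ → ℝ := fun j => (2 / ℓ) * (sinCoef ℓ f j) ^ 2 with hp
  have hqp : ∀ j, q j = lamE ℓ j ^ 2 * p j := by
    intro j; simp only [hq, hp]; rw [sinCoef_deriv2 ℓ hl f f1 f2 h]; ring
  have hp0 : ∀ j, 0 ≤ p j := fun j => by simp only [hp]; positivity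
  have SD : HasSum q D := sine_parseval ℓ hl f2 h.c2
  have Sf : HasSum p (∫ x in (0:ℝ)..ℓ, (f x) ^ 2) := sine_parseval ℓ hl f h.c0
  have SG := navier_hasSum ℓ hl f f1 f2 h
  have low := dirichlet_low ℓ hl f f1 f2 h y0 yl
  have low' : (1 + 6 / Real.pi ^ 2) * (q 0 + q 1) ≤ D := low
  have h16 : (8 / 5) * (q 0 + q 1) ≤ D := by
    refine le_trans ?_ low'
    apply mul_le_mul_of_nonneg_right
    · have : Real.pi ^ 2 ≤ 10 := by nlinarith [Real.pi_lt_d2, Real.pi_pos]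
      have : 6 / 10 ≤ 6 / Real.pi ^ 2 := by gcongr
      linarith
    · have := hp0 0; have := hp0 1; rw [hqp, hqp]; positivity
  have c0 : HasSum (fun j : ℕ => if j = 0 then q 0 else 0) (q 0) := hasSum_ite_eq 0 (q 0)
  have c1 : HasSum (fun j : ℕ => if j = 1 then q 1 else 0) (q 1) := hasSum_ite_eq 1 (q 1)
  have S1 := ((Sf.mul_left (9 / 25)).add ((SD.sub (c0.add c1)).mul_left (2 / 5)))
  have r1 := hasSum_le (fun j => ?_) S1 SG
  have r2 : 4 / 25 * ∫ x in (0:ℝ)..ℓ, (f x) ^ 2 ≤ D := by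
    refine hasSum_le (fun j => ?_) (Sf.mul_left (4 / 25)) SD
    rw [hqp, hlam]
    apply mul_le_mul_of_nonneg_right _ (hp0 j)
    have : (0:ℝ) ≤ j := Nat.cast_nonneg j
    have : (1:ℝ) ≤ (j + 1) ^ 2 := by nlinarith
    nlinarith
  · have : 0 ≤ ∫ x in (0:ℝ)..ℓ, (f x) ^ 2 :=
      intervalIntegral.integral_nonneg hl.le (fun x _ => sq_nonneg _)
    linarith
  · show 9 / 25 * p j + 2 / 5 * (q j - _) ≤ (1 - lamE ℓ j) ^ 2 * p j
    match j with
    | 0 => simp [hlam]; linarith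
    | 1 => simp [hlam]; linarith
    | (k + 2) =>
      simp only [hqp, hlam]
      simp
      have := hp0 (k + 2)
      have hk : (0:ℝ) ≤ k := Nat.cast_nonneg k
      have h9 : (9:ℝ) ≤ (k + 2 + 1) ^ 2 := by nlinarith
      set m : ℝ := (k + 2 + 1) ^ 2
      have : 9 / 25 + 2 / 5 * (2 / 5 * m) ^ 2 ≤ (1 - 2 / 5 * m) ^ 2 := by nlinarith
      nlinarith


/-- `C²` functions on the closed strip `ℝ × [0, ℓ]` vanishing on the edges and for large `|t|`. -/
structure StripC2 (ℓ : ℝ) (w w1 w11 w2 w22 : ℝ → ℝ → ℝ) : Prop where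
  c : Continuous (Function.uncurry w)
  c1 : Continuous (Function.uncurry w1)
  c11 : Continuous (Function.uncurry w11)
  c22 : Continuous (Function.uncurry w22)
  dt1 : ∀ x ∈ Icc 0 ℓ, ∀ t, HasDerivAt (fun s => w s x) (w1 t x) t
  dt2 : ∀ x ∈ Icc 0 ℓ, ∀ t, HasDerivAt (fun s => w1 s x) (w11 t x) t
  row : ∀ t, IntervalC2 ℓ (w t) (w2 t) (w22 t)
  supp : ∃ R : ℝ, ∀ t, R < |t| → ∀ x, w t x = 0 ∧ w1 t x = 0 ∧ w11 t x = 0 ∧ w22 t x = 0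

lemma compSupp_integrable (a : ℝ → ℝ) (ha : Continuous a) (R : ℝ) (h : ∀ t, R < |t| → a t = 0) :
    Integrable a := by
  apply ha.integrable_of_hasCompactSupport
  apply HasCompactSupport.of_support_subset_isCompact (isCompact_Icc (a := -R) (b := R))
  intro t ht
  by_contra hc
  apply ht
  apply h
  by_contra hh
  exact hc (abs_le.1 (not_lt.1 hh))

lemma ode_energy (κ : ℝ) (hκ : κ ≤ 1) (a a1 a2 : ℝ → ℝ) (h1 : ∀ t, HasDerivAt a (a1 t) t)
    (h2 : ∀ t, HasDerivAt a1 (a2 t) t) (hc : Continuous a2) (R : ℝ)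
    (hR : ∀ t, R < |t| → a t = 0 ∧ a1 t = 0 ∧ a2 t = 0) :
    κ ^ 2 * ∫ t, (a t) ^ 2 ≤ ∫ t, (a2 t + 2 * a1 t + κ * a t) ^ 2 := by
  have ca : Continuous a := continuous_iff_continuousAt.2 fun t => (h1 t).continuousAt
  have ca1 : Continuous a1 := continuous_iff_continuousAt.2 fun t => (h2 t).continuousAt
  have z : ∫ t, (4 * a1 t * a2 t + 2 * κ * (a1 t * a1 t + a t * a2 t) + 4 * κ * a t * a1 t) = 0 := by
    apply integral_eq_zero_of_hasDerivAt_of_integrable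
      (f := fun t => 2 * (a1 t) ^ 2 + 2 * κ * (a t * a1 t) + 2 * κ * (a t) ^ 2)
    · intro t
      have := ((((h2 t).pow 2).const_mul 2).add (((h1 t).mul (h2 t)).const_mul (2 * κ))).add
        (((h1 t).pow 2).const_mul (2 * κ))
      convert! this using 1
      simp
      ring
    · apply compSupp_integrable _ (by fun_prop) R
      intro t ht
      obtain ⟨e0, e1, e2⟩ := hR t ht
      simp [e0, e1, e2]
    · apply compSupp_integrable _ (by fun_prop) R
      intro t ht
      obtain ⟨e0, e1, e2⟩ := hR t ht
      simp [e0, e1]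
  have i1 : Integrable (fun t => κ ^ 2 * (a t) ^ 2) := by
    apply compSupp_integrable _ (by fun_prop) R
    intro t ht; simp [(hR t ht).1]
  have i2 : Integrable (fun t => (a2 t) ^ 2 + (4 - 2 * κ) * (a1 t) ^ 2) := by
    apply compSupp_integrable _ (by fun_prop) R
    intro t ht; simp [(hR t ht).2]
  have i3 : Integrable (fun t =>
      (4 * a1 t * a2 t + 2 * κ * (a1 t * a1 t + a t * a2 t) + 4 * κ * a t * a1 t)) := by
    apply compSupp_integrable _ (by fun_prop) R
    intro t ht; simp [(hR t ht)]
  have e : ∀ t, (a2 t + 2 * a1 t + κ * a t) ^ 2 = (κ ^ 2 * (a t) ^ 2 +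
      ((a2 t) ^ 2 + (4 - 2 * κ) * (a1 t) ^ 2)) +
      (4 * a1 t * a2 t + 2 * κ * (a1 t * a1 t + a t * a2 t) + 4 * κ * a t * a1 t) := by
    intro t; ring
  simp_rw [e]
  have i12 : Integrable (fun t => κ ^ 2 * (a t) ^ 2 + ((a2 t) ^ 2 + (4 - 2 * κ) * (a1 t) ^ 2)) :=
    i1.add i2
  rw [integral_add i12 i3, z, integral_add i1 i2, integral_const_mul]
  have : 0 ≤ ∫ t, ((a2 t) ^ 2 + (4 - 2 * κ) * (a1 t) ^ 2) := by
    apply integral_nonneg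
    intro t
    have : 0 ≤ 4 - 2 * κ := by linarith
    show 0 ≤ (a2 t) ^ 2 + (4 - 2 * κ) * (a1 t) ^ 2
    positivity
  linarith

lemma param_deriv (ℓ : ℝ) (hl : 0 < ℓ) (g g1 : ℝ → ℝ → ℝ) (hg : Continuous (Function.uncurry g))
    (hg1 : Continuous (Function.uncurry g1))
    (hd : ∀ x ∈ Icc 0 ℓ, ∀ t, HasDerivAt (fun s => g s x) (g1 t x) t) (t : ℝ) :
    HasDerivAt (fun s => ∫ x in (0:ℝ)..ℓ, g s x) (∫ x in (0:ℝ)..ℓ, g1 t x) t := by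
  obtain ⟨C, hC⟩ := ((isCompact_Icc (a := t - 1) (b := t + 1)).prod
    (isCompact_Icc (a := (0:ℝ)) (b := ℓ))).exists_bound_of_continuousOn hg1.continuousOn
  have row : ∀ s, Continuous (g s) := fun s => hg.comp (by fun_prop : Continuous fun x => (s, x))
  have row1 : ∀ s, Continuous (g1 s) := fun s => hg1.comp (by fun_prop : Continuous fun x => (s, x))
  refine (intervalIntegral.hasDerivAt_integral_of_dominated_loc_of_deriv_le
    (bound := fun _ => C) (Icc_mem_nhds (by linarith : t - 1 < t) (by linarith : t < t + 1))
    (Eventually.of_forall fun s => (row s).aestronglyMeasurable)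
    ((row t).intervalIntegrable _ _) (row1 t).aestronglyMeasurable
    (ae_of_all _ fun x hx s hs => ?_) intervalIntegrable_const
    (ae_of_all _ fun x hx s hs => ?_)).2
  · rw [uIoc_of_le hl.le] at hx
    exact hC (s, x) ⟨hs, hx.1.le, hx.2⟩
  · rw [uIoc_of_le hl.le] at hx
    exact hd x ⟨hx.1.le, hx.2⟩ s

lemma sinCoef_continuous (ℓ : ℝ) (g : ℝ → ℝ → ℝ) (hg : Continuous (Function.uncurry g)) (j : ℕ) :
    Continuous (fun t => sinCoef ℓ (g t) j) := by
  unfold sinCoef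
  apply intervalIntegral.continuous_parametric_intervalIntegral_of_continuous'
  exact hg.mul (by fun_prop : Continuous fun p : ℝ × ℝ => Real.sin ((j + 1) * Real.pi / ℓ * p.2))

lemma sinCoef_hasDerivAt (ℓ : ℝ) (hl : 0 < ℓ) (g g1 : ℝ → ℝ → ℝ)
    (hg : Continuous (Function.uncurry g)) (hg1 : Continuous (Function.uncurry g1))
    (hd : ∀ x ∈ Icc 0 ℓ, ∀ t, HasDerivAt (fun s => g s x) (g1 t x) t) (j : ℕ) (t : ℝ) :
    HasDerivAt (fun s => sinCoef ℓ (g s) j) (sinCoef ℓ (g1 t) j) t := by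
  unfold sinCoef
  have hs : Continuous fun p : ℝ × ℝ => Real.sin ((j + 1) * Real.pi / ℓ * p.2) := by fun_prop
  exact param_deriv ℓ hl (fun s x => g s x * Real.sin ((j + 1) * Real.pi / ℓ * x))
    (fun s x => g1 s x * Real.sin ((j + 1) * Real.pi / ℓ * x)) (hg.mul hs) (hg1.mul hs)
    (fun x hx t => (hd x hx t).mul_const _) t

lemma hasSum_integral_sq (ℓ : ℝ) (hl : 0 < ℓ) (g : ℝ → ℝ → ℝ)
    (hg : Continuous (Function.uncurry g)) (R : ℝ) (hR : ∀ t, R < |t| → ∀ x, g t x = 0) :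
    HasSum (fun j : ℕ => ∫ t, (2 / ℓ) * (sinCoef ℓ (g t) j) ^ 2)
      (∫ t, ∫ x in (0:ℝ)..ℓ, (g t x) ^ 2) := by
  have row : ∀ s, Continuous (g s) := fun s => hg.comp (by fun_prop : Continuous fun x => (s, x))
  have hp : ∀ t, HasSum (fun j : ℕ => (2 / ℓ) * (sinCoef ℓ (g t) j) ^ 2)
      (∫ x in (0:ℝ)..ℓ, (g t x) ^ 2) := fun t => sine_parseval ℓ hl (g t) (row t)
  refine hasSum_integral_of_dominated_convergence
    (fun (j : ℕ) t => (2 / ℓ) * (sinCoef ℓ (g t) j) ^ 2) (fun j => ?_) (fun j => ?_)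
    (ae_of_all _ fun t => (hp t).summable) ?_ (ae_of_all _ hp)
  · have := sinCoef_continuous ℓ g hg j
    exact Continuous.aestronglyMeasurable (by fun_prop)
  · refine ae_of_all _ fun t => ?_
    rw [Real.norm_of_nonneg (by positivity)]
  · simp_rw [(hp _).tsum_eq]
    apply compSupp_integrable _ _ R
    · intro t ht
      simp [hR t ht]
    · apply intervalIntegral.continuous_parametric_intervalIntegral_of_continuous'
      exact hg.pow 2

lemma lamE_nonneg (ℓ : ℝ) (j : ℕ) : 0 ≤ lamE ℓ j := sq_nonneg _

lemma sinCoef_const_mul (ℓ k : ℝ) (f : ℝ → ℝ) (j : ℕ) :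
    sinCoef ℓ (fun x => k * f x) j = k * sinCoef ℓ f j := by
  unfold sinCoef
  rw [← intervalIntegral.integral_const_mul]
  simp_rw [mul_assoc]

lemma strip_energy (ℓ : ℝ) (hl : 0 < ℓ) (w w1 w11 w2 w22 : ℝ → ℝ → ℝ)
    (h : StripC2 ℓ w w1 w11 w2 w22) :
    ∫ t, ∫ x in (0:ℝ)..ℓ, (w22 t x + w t x) ^ 2 ≤
      ∫ t, ∫ x in (0:ℝ)..ℓ, ((w11 t x + 2 * w1 t x) + (w22 t x + w t x)) ^ 2 := by
  obtain ⟨R, hR⟩ := h.supp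
  have hc := h.c; have hc1 := h.c1; have hc11 := h.c11; have hc22 := h.c22
  have S1 := hasSum_integral_sq ℓ hl (fun t x => w22 t x + w t x) (hc22.add hc) R
    (fun t ht x => by simp [hR t ht x])
  have S2 := hasSum_integral_sq ℓ hl
    (fun t x => (w11 t x + 2 * w1 t x) + (w22 t x + w t x))
    ((hc11.add (hc1.const_mul 2)).add (hc22.add hc)) R (fun t ht x => by simp [hR t ht x])
  refine hasSum_le (fun j => ?_) S1 S2
  rw [integral_const_mul, integral_const_mul]
  apply mul_le_mul_of_nonneg_left _ (by positivity)
  have row : ∀ {g : ℝ → ℝ → ℝ} (hg : Continuous (Function.uncurry g)) s, Continuous (g s) :=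
    fun hg s => hg.comp (by fun_prop : Continuous fun x => (s, x))
  have e1 : ∀ t, sinCoef ℓ (fun x => w22 t x + w t x) j = (1 - lamE ℓ j) * sinCoef ℓ (w t) j := by
    intro t
    rw [sinCoef_add ℓ _ _ (row hc22 t) (row hc t), sinCoef_deriv2 ℓ hl _ _ _ (h.row t)]
    ring
  have e2 : ∀ t, sinCoef ℓ (fun x => (w11 t x + 2 * w1 t x) + (w22 t x + w t x)) j =
      sinCoef ℓ (w11 t) j + 2 * sinCoef ℓ (w1 t) j + (1 - lamE ℓ j) * sinCoef ℓ (w t) j := by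
    intro t
    rw [sinCoef_add ℓ (fun x => w11 t x + 2 * w1 t x) (fun x => w22 t x + w t x)
      ((row hc11 t).add ((row hc1 t).const_mul 2))
      ((row hc22 t).add (row hc t)), e1,
      sinCoef_add ℓ (w11 t) (fun x => 2 * w1 t x) (row hc11 t) ((row hc1 t).const_mul 2), sinCoef_const_mul]
  simp_rw [e1, e2, mul_pow]
  rw [integral_const_mul]
  apply ode_energy _ (by linarith [lamE_nonneg ℓ j]) _ _ _
    (sinCoef_hasDerivAt ℓ hl w w1 hc hc1 h.dt1 j) (sinCoef_hasDerivAt ℓ hl w1 w11 hc1 hc11 h.dt2 j)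
    (sinCoef_continuous ℓ w11 hc11 j) R
  intro t ht
  simp [sinCoef, hR t ht]

lemma strip_navier (ℓ : ℝ) (hl : 0 < ℓ) (μ : ℝ) (w w1 w11 w2 w22 : ℝ → ℝ → ℝ)
    (h : StripC2 ℓ w w1 w11 w2 w22)
    (hμ : ∀ t, μ * ∫ x in (0:ℝ)..ℓ, (w t x) ^ 2 ≤ ∫ x in (0:ℝ)..ℓ, (w22 t x + w t x) ^ 2) :
    μ * ∫ t, ∫ x in (0:ℝ)..ℓ, (w t x) ^ 2 ≤
      ∫ t, ∫ x in (0:ℝ)..ℓ, ((w11 t x + 2 * w1 t x) + (w22 t x + w t x)) ^ 2 := by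
  refine le_trans ?_ (strip_energy ℓ hl w w1 w11 w2 w22 h)
  obtain ⟨R, hR⟩ := h.supp
  rw [← integral_const_mul]
  apply integral_mono _ _ hμ
  · apply Integrable.const_mul
    apply compSupp_integrable _ _ R
    · intro t ht; simp [hR t ht]
    · apply intervalIntegral.continuous_parametric_intervalIntegral_of_continuous'
      exact h.c.pow 2
  · apply compSupp_integrable _ _ R
    · intro t ht; simp [hR t ht]
    · apply intervalIntegral.continuous_parametric_intervalIntegral_of_continuous'
      exact (h.c22.add h.c).pow 2


/-- Logarithmic polar coordinates. -/
def pm (α : ℝ) (p : ℝ × ℝ) : EuclideanSpace ℝ (Fin 2) :=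
  !₂[Real.exp p.1 * Real.cos (α + p.2), Real.exp p.1 * Real.sin (α + p.2)]

@[simp] lemma pm_zero (α : ℝ) (p : ℝ × ℝ) : pm α p 0 = Real.exp p.1 * Real.cos (α + p.2) := rfl
@[simp] lemma pm_one (α : ℝ) (p : ℝ × ℝ) : pm α p 1 = Real.exp p.1 * Real.sin (α + p.2) := rfl

lemma norm_eq_of_polar (x : EuclideanSpace ℝ (Fin 2)) (r s : ℝ) (hr : 0 ≤ r)
    (h0 : x 0 = r * Real.cos s) (h1 : x 1 = r * Real.sin s) : ‖x‖ = r := by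
  rw [EuclideanSpace.norm_eq, Fin.sum_univ_two, h0, h1]
  rw [Real.norm_eq_abs, Real.norm_eq_abs, sq_abs, sq_abs]
  rw [show (r * Real.cos s) ^ 2 + (r * Real.sin s) ^ 2 = r ^ 2 by
    nlinarith [Real.sin_sq_add_cos_sq s]]
  exact Real.sqrt_sq hr

lemma pm_norm (α : ℝ) (p : ℝ × ℝ) : ‖pm α p‖ = Real.exp p.1 :=
  norm_eq_of_polar _ _ (α + p.2) (Real.exp_pos _).le rfl rfl

lemma pm_ne_zero (α : ℝ) (p : ℝ × ℝ) : pm α p ≠ 0 := by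
  rw [← norm_ne_zero_iff, pm_norm]
  exact (Real.exp_pos _).ne'

lemma pm_contDiff (α : ℝ) : ContDiff ℝ 2 (pm α) := by
  rw [contDiff_euclidean]
  intro i
  fin_cases i
  · show ContDiff ℝ 2 (fun p : ℝ × ℝ => Real.exp p.1 * Real.cos (α + p.2))
    fun_prop
  · show ContDiff ℝ 2 (fun p : ℝ × ℝ => Real.exp p.1 * Real.sin (α + p.2))
    fun_prop

lemma exists_polar (c : ℝ) (x : EuclideanSpace ℝ (Fin 2)) :
    ∃ y : ℝ, |y| ≤ Real.pi ∧ x 0 = ‖x‖ * Real.cos (c + y) ∧ x 1 = ‖x‖ * Real.sin (c + y) := by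
  set z : ℂ := ⟨x 0, x 1⟩ with hz
  have hzn : ‖z‖ = ‖x‖ := by
    rw [EuclideanSpace.norm_eq, Fin.sum_univ_two, Complex.norm_eq_sqrt_sq_add_sq]
    simp [hz]
  set e : ℂ := Complex.exp (-(c : ℂ) * Complex.I) with he
  have hen : ‖z * e‖ = ‖x‖ := by
    rw [norm_mul, hzn, he, ← Complex.ofReal_neg, Complex.norm_exp_ofReal_mul_I, mul_one]
  refine ⟨Complex.arg (z * e), Complex.abs_arg_le_pi _, ?_⟩
  have key : z = (‖x‖ : ℂ) * Complex.exp (((c + Complex.arg (z * e) : ℝ) : ℂ) * Complex.I) := by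
    have h1 := Complex.norm_mul_exp_arg_mul_I (z * e)
    rw [hen] at h1
    push_cast
    rw [add_mul, Complex.exp_add, mul_left_comm, h1, he, mul_left_comm, ← Complex.exp_add]
    simp
  constructor
  · have := congrArg Complex.re key
    rw [Complex.re_ofReal_mul, Complex.exp_ofReal_mul_I_re] at this
    exact this
  · have := congrArg Complex.im key
    rw [Complex.im_ofReal_mul, Complex.exp_ofReal_mul_I_im] at this
    exact this

/-- Unit vector at angle `c`. -/
def uvec (c : ℝ) : EuclideanSpace ℝ (Fin 2) := !₂[Real.cos c, Real.sin c]

lemma inner_uvec (c : ℝ) (x : EuclideanSpace ℝ (Fin 2)) :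
    ⟪x, uvec c⟫ = x 0 * Real.cos c + x 1 * Real.sin c := by
  simp [uvec, PiLp.inner_apply, Fin.sum_univ_two]
  ring

lemma inner_polar (c r y : ℝ) (x : EuclideanSpace ℝ (Fin 2))
    (h0 : x 0 = r * Real.cos (c + y)) (h1 : x 1 = r * Real.sin (c + y)) :
    ⟪x, uvec c⟫ = r * Real.cos y := by
  rw [inner_uvec, h0, h1]
  have : Real.cos y = Real.cos ((c + y) - c) := by congr 1; ring
  rw [this, Real.cos_sub]
  ring

lemma cos_lt_iff_abs {θ y : ℝ} (h0 : 0 < θ) (h1 : θ < Real.pi) (hy : |y| ≤ Real.pi) :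
    Real.cos θ < Real.cos y ↔ |y| < θ := by
  rw [← Real.cos_abs y]
  exact Real.strictAntiOn_cos.lt_iff_gt ⟨h0.le, h1.le⟩ ⟨abs_nonneg y, hy⟩

lemma cone_eq_image (c θ : ℝ) :
    coneOf (arcSet c θ) = pm (c - θ) '' (univ ×ˢ Ioo 0 (2 * θ)) := by
  ext x
  simp only [coneOf, arcSet, mem_setOf_eq, mem_image, mem_prod, mem_univ, true_and, Prod.exists]
  constructor
  · rintro ⟨hx, t, ht, h0, h1⟩
    have hn : 0 < ‖x‖ := norm_pos_iff.2 hx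
    rw [abs_lt] at ht
    refine ⟨Real.log ‖x‖, t - (c - θ), ⟨by linarith, by linarith⟩, ?_⟩
    simp only [PiLp.smul_apply, smul_eq_mul] at h0 h1
    ext i
    fin_cases i
    · simp [Real.exp_log hn, ← h0, hn.ne']
    · simp [Real.exp_log hn, ← h1, hn.ne']
  · rintro ⟨t, y, hy, rfl⟩
    refine ⟨pm_ne_zero _ _, c - θ + y, by rw [abs_lt]; constructor <;> linarith [hy.1, hy.2], ?_⟩
    rw [pm_norm]
    simp [← mul_assoc]

lemma cone_eq_inner (c θ : ℝ) (h0 : 0 < θ) (h1 : θ < Real.pi) :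
    coneOf (arcSet c θ) = {x | ‖x‖ * Real.cos θ < ⟪x, uvec c⟫} := by
  ext x
  simp only [mem_setOf_eq]
  obtain ⟨y, hy, e0, e1⟩ := exists_polar c x
  rw [inner_polar c _ y x e0 e1]
  constructor
  · rw [cone_eq_image]
    rintro ⟨⟨t, y'⟩, hy', hx⟩
    simp only [mem_prod, mem_univ, true_and] at hy'
    have e0' : x 0 = Real.exp t * Real.cos (c + (y' - θ)) := by
      rw [← hx, pm_zero]; congr 2; simp; ring
    have e1' : x 1 = Real.exp t * Real.sin (c + (y' - θ)) := by
      rw [← hx, pm_one]; congr 2; simp; ring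
    have hn := norm_eq_of_polar _ _ _ (Real.exp_pos t).le e0' e1'
    have a1 := inner_polar c _ _ x e0' e1'
    have a2 := inner_polar c _ _ x e0 e1
    rw [← a2, a1, hn]
    have hab : |y' - θ| < θ := by rw [abs_lt]; constructor <;> linarith [hy'.1, hy'.2]
    exact mul_lt_mul_of_pos_left ((cos_lt_iff_abs h0 h1 (by linarith)).2 hab) (Real.exp_pos t)
  · intro h
    have hx : x ≠ 0 := by rintro rfl; simp at h
    have hn : 0 < ‖x‖ := norm_pos_iff.2 hx
    have hab := (cos_lt_iff_abs h0 h1 hy).1 (lt_of_mul_lt_mul_left h hn.le)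
    refine ⟨hx, c + y, by simpa using hab, ?_, ?_⟩
    · rw [PiLp.smul_apply, e0, smul_eq_mul, ← mul_assoc, inv_mul_cancel₀ hn.ne', one_mul]
    · rw [PiLp.smul_apply, e1, smul_eq_mul, ← mul_assoc, inv_mul_cancel₀ hn.ne', one_mul]

lemma cone_open (c θ : ℝ) (h0 : 0 < θ) (h1 : θ < Real.pi) : IsOpen (coneOf (arcSet c θ)) := by
  rw [cone_eq_inner c θ h0 h1]
  exact isOpen_lt (by fun_prop) (by fun_prop)

lemma cone_closure_sub (c θ : ℝ) (h0 : 0 < θ) (h1 : θ < Real.pi) :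
    closure (coneOf (arcSet c θ)) ⊆ {x | ‖x‖ * Real.cos θ ≤ ⟪x, uvec c⟫} := by
  rw [cone_eq_inner c θ h0 h1]
  apply closure_lt_subset_le <;> fun_prop

lemma pm_mem_closure (c θ : ℝ) (h0 : 0 < θ) (t x : ℝ) (hx : x ∈ Icc 0 (2 * θ)) :
    pm (c - θ) (t, x) ∈ closure (coneOf (arcSet c θ)) := by
  rw [cone_eq_image]
  apply image_closure_subset_closure_image (pm_contDiff _).continuous
  apply mem_image_of_mem
  rw [closure_prod_eq, closure_Ioo (by linarith : (0:ℝ) ≠ 2 * θ)]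
  simpa using hx

lemma pm_mem_cone (c θ : ℝ) (t x : ℝ) (hx : x ∈ Ioo 0 (2 * θ)) :
    pm (c - θ) (t, x) ∈ coneOf (arcSet c θ) := by
  rw [cone_eq_image]
  exact mem_image_of_mem _ (by simpa using hx)

lemma pm_mem_frontier (c θ : ℝ) (h0 : 0 < θ) (h1 : θ < Real.pi) (t x : ℝ)
    (hx : x = 0 ∨ x = 2 * θ) :
    pm (c - θ) (t, x) ∈ frontier (coneOf (arcSet c θ)) := by
  rw [(cone_open c θ h0 h1).frontier_eq]
  refine ⟨pm_mem_closure c θ h0 t x ?_, ?_⟩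
  · rcases hx with rfl | rfl <;> constructor <;> linarith
  · rw [cone_eq_inner c θ h0 h1, mem_setOf_eq, pm_norm]
    rw [inner_polar c (Real.exp t) (x - θ) _ (by rw [pm_zero]; congr 2; simp; ring)
      (by rw [pm_one]; congr 2; simp; ring)]
    rcases hx with rfl | rfl
    · simp
    · rw [show 2 * θ - θ = θ by ring]; simp

lemma closure_polar (c θ : ℝ) (h0 : 0 < θ) (h1 : θ < Real.pi) (x : EuclideanSpace ℝ (Fin 2))
    (hx : x ≠ 0) (hc : x ∈ closure (coneOf (arcSet c θ))) :
    ∃ y ∈ Icc 0 (2 * θ), x = pm (c - θ) (Real.log ‖x‖, y) := by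
  have h := cone_closure_sub c θ h0 h1 hc
  obtain ⟨y, hy, e0, e1⟩ := exists_polar c x
  rw [mem_setOf_eq, inner_polar c _ y x e0 e1] at h
  have hn : 0 < ‖x‖ := norm_pos_iff.2 hx
  have h' := le_of_mul_le_mul_left h hn
  rw [← Real.cos_abs y] at h'
  have hab := (Real.strictAntiOn_cos.le_iff_ge ⟨h0.le, h1.le⟩ ⟨abs_nonneg y, hy⟩).1 h'
  rw [abs_le] at hab
  refine ⟨y + θ, ⟨by linarith, by linarith⟩, ?_⟩
  ext i
  fin_cases i
  · simp only [Fin.zero_eta, pm_zero, Real.exp_log hn]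
    rw [e0]; congr 2; ring
  · simp only [Fin.mk_one, pm_one, Real.exp_log hn]
    rw [e1]; congr 2; ring

lemma frontier_polar (c θ : ℝ) (h0 : 0 < θ) (h1 : θ < Real.pi) (x : EuclideanSpace ℝ (Fin 2))
    (hx : x ≠ 0) (hc : x ∈ frontier (coneOf (arcSet c θ))) :
    ∃ y, (y = 0 ∨ y = 2 * θ) ∧ x = pm (c - θ) (Real.log ‖x‖, y) := by
  obtain ⟨y, hy, e⟩ := closure_polar c θ h0 h1 x hx (frontier_subset_closure hc)
  refine ⟨y, ?_, e⟩
  by_contra! hh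
  rw [(cone_open c θ h0 h1).frontier_eq] at hc
  apply hc.2
  rw [e]
  exact pm_mem_cone c θ _ _ ⟨lt_of_le_of_ne hy.1 hh.1.symm, lt_of_le_of_ne hy.2 hh.2⟩


/-- The derivative of the logarithmic polar coordinates. -/
def pmD (α : ℝ) (p : ℝ × ℝ) : ℝ × ℝ →L[ℝ] ℝ × ℝ :=
  (Matrix.toLin (.finTwoProd ℝ) (.finTwoProd ℝ)
    !![Real.exp p.1 * Real.cos (α + p.2), -(Real.exp p.1 * Real.sin (α + p.2));
       Real.exp p.1 * Real.sin (α + p.2), Real.exp p.1 * Real.cos (α + p.2)]).toContinuousLinearMap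

lemma pmD_det (α : ℝ) (p : ℝ × ℝ) : (pmD α p).det = Real.exp (2 * p.1) := by
  unfold pmD
  simp only [LinearMap.det_toContinuousLinearMap, LinearMap.det_toLin, Matrix.det_fin_two_of]
  rw [two_mul, Real.exp_add]
  linear_combination (Real.exp p.1) ^ 2 * (Real.sin_sq_add_cos_sq (α + p.2))

lemma pmD_hasFDerivAt (α : ℝ) (p : ℝ × ℝ) :
    HasFDerivAt (fun p : ℝ × ℝ => (Real.exp p.1 * Real.cos (α + p.2),
      Real.exp p.1 * Real.sin (α + p.2))) (pmD α p) p := by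
  unfold pmD
  rw [Matrix.toLin_finTwoProd_toContinuousLinearMap]
  have hs : HasFDerivAt (fun p : ℝ × ℝ => α + p.2) (ContinuousLinearMap.snd ℝ ℝ ℝ) p :=
    hasFDerivAt_snd.const_add α
  have h1 := (hasFDerivAt_fst (𝕜 := ℝ) (p := p)).exp.mul
    ((Real.hasDerivAt_cos (α + p.2)).comp_hasFDerivAt p hs)
  have h2 := (hasFDerivAt_fst (𝕜 := ℝ) (p := p)).exp.mul
    ((Real.hasDerivAt_sin (α + p.2)).comp_hasFDerivAt p hs)
  convert! h1.prodMk h2 using 2 <;> ext <;> simp <;> ring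

lemma pm_injOn (c θ : ℝ) (h1 : θ < Real.pi) :
    InjOn (pm (c - θ)) (univ ×ˢ Ioo 0 (2 * θ)) := by
  rintro ⟨t, x⟩ hx ⟨t', x'⟩ hx' h
  simp only [mem_prod, mem_univ, true_and] at hx hx'
  have hn := congrArg norm h
  rw [pm_norm, pm_norm] at hn
  have ht : t = t' := Real.exp_injective hn
  subst ht
  have e0 : Real.cos (c - θ + x) = Real.cos (c - θ + x') := by
    have : pm (c - θ) (t, x) 0 = pm (c - θ) (t, x') 0 := by rw [h]
    simpa using this
  have e1 : Real.sin (c - θ + x) = Real.sin (c - θ + x') := by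
    have : pm (c - θ) (t, x) 1 = pm (c - θ) (t, x') 1 := by rw [h]
    simpa using this
  have := Real.Angle.cos_sin_inj e0 e1
  rw [Real.Angle.angle_eq_iff_two_pi_dvd_sub] at this
  obtain ⟨k, hk⟩ := this
  have hpi := Real.pi_pos
  have k1 : (k : ℝ) < 1 := by
    by_contra! hh
    nlinarith [hx.1, hx.2, hx'.1, hx'.2]
  have k2 : (-1 : ℝ) < k := by
    by_contra! hh
    nlinarith [hx.1, hx.2, hx'.1, hx'.2]
  have k0 : k = 0 := by
    have a1 : k < 1 := by exact_mod_cast k1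
    have a2 : -1 < k := by exact_mod_cast k2
    omega
  rw [k0] at hk
  simp at hk
  rw [Prod.mk.injEq]
  exact ⟨rfl, by linarith⟩

lemma cone_integral (c θ : ℝ) (h1 : θ < Real.pi) (f : EuclideanSpace ℝ (Fin 2) → ℝ) :
    ∫ x in coneOf (arcSet c θ), f x =
      ∫ p in univ ×ˢ Ioo 0 (2 * θ), Real.exp (2 * p.1) * f (pm (c - θ) p) := by
  have mp : MeasurePreserving (fun q : ℝ × ℝ => WithLp.toLp 2 ((MeasurableEquiv.finTwoArrow (α := ℝ)).symm q)) :=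
    (PiLp.volume_preserving_toLp (Fin 2)).comp ((volume_preserving_finTwoArrow ℝ).symm _)
  have me : MeasurableEmbedding (fun q : ℝ × ℝ => WithLp.toLp 2 ((MeasurableEquiv.finTwoArrow (α := ℝ)).symm q)) :=
    (MeasurableEquiv.toLp 2 (Fin 2 → ℝ)).measurableEmbedding.comp
      (MeasurableEquiv.finTwoArrow (α := ℝ)).symm.measurableEmbedding
  rw [← mp.setIntegral_preimage_emb me]
  have hpm : ∀ p, pm (c - θ) p = WithLp.toLp 2 ((MeasurableEquiv.finTwoArrow (α := ℝ)).symm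
      (Real.exp p.1 * Real.cos (c - θ + p.2), Real.exp p.1 * Real.sin (c - θ + p.2))) := by
    intro p
    ext i
    fin_cases i <;> rfl
  have hpre : (fun q : ℝ × ℝ => WithLp.toLp 2 ((MeasurableEquiv.finTwoArrow (α := ℝ)).symm q)) ⁻¹'
      coneOf (arcSet c θ) = (fun p : ℝ × ℝ => (Real.exp p.1 * Real.cos (c - θ + p.2),
      Real.exp p.1 * Real.sin (c - θ + p.2))) '' (univ ×ˢ Ioo 0 (2 * θ)) := by
    rw [cone_eq_image, show pm (c - θ) = (fun q : ℝ × ℝ => WithLp.toLp 2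
      ((MeasurableEquiv.finTwoArrow (α := ℝ)).symm q)) ∘ (fun p : ℝ × ℝ =>
      (Real.exp p.1 * Real.cos (c - θ + p.2), Real.exp p.1 * Real.sin (c - θ + p.2))) from
      funext hpm, image_comp, preimage_image_eq _ me.injective]
  rw [hpre, integral_image_eq_integral_abs_det_fderiv_smul volume
    (MeasurableSet.univ.prod measurableSet_Ioo)
    (fun p _ => (pmD_hasFDerivAt (c - θ) p).hasFDerivWithinAt)]
  · simp_rw [pmD_det, abs_of_pos (Real.exp_pos _), smul_eq_mul, ← hpm]
  · intro p hp q hq h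
    apply pm_injOn c θ h1 hp hq
    rw [hpm, hpm]
    simp only at h
    rw [h]

lemma strip_integral (ℓ : ℝ) (hl : 0 < ℓ) (g : ℝ → ℝ → ℝ) (hg : Continuous (Function.uncurry g))
    (R : ℝ) (hR : ∀ t, R < |t| → ∀ x, g t x = 0) :
    ∫ p in univ ×ˢ Ioo 0 ℓ, g p.1 p.2 = ∫ t, ∫ x in (0:ℝ)..ℓ, g t x := by
  have hi : IntegrableOn (Function.uncurry g) (univ ×ˢ Ioo 0 ℓ) (volume.prod volume) := by
    have h1 : IntegrableOn (Function.uncurry g) (Icc (-R) R ×ˢ Icc 0 ℓ) (volume.prod volume) :=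
      hg.continuousOn.integrableOn_compact (isCompact_Icc.prod isCompact_Icc)
    have h2 : IntegrableOn (Function.uncurry g) ((univ ×ˢ Ioo 0 ℓ) \ (Icc (-R) R ×ˢ Icc 0 ℓ))
        (volume.prod volume) := by
      apply IntegrableOn.congr_fun (f := fun _ => (0:ℝ)) integrableOn_zero
      · rintro ⟨t, x⟩ ⟨hm, hn⟩
        simp only [mem_prod, mem_univ, true_and] at hm hn
        symm
        apply hR
        by_contra! hh
        exact hn ⟨abs_le.1 hh, hm.1.le, hm.2.le⟩
      · exact (MeasurableSet.univ.prod measurableSet_Ioo).diff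
          (measurableSet_Icc.prod measurableSet_Icc)
    exact (h1.union h2).mono_set (by intro p hp; by_cases h : p ∈ Icc (-R) R ×ˢ Icc 0 ℓ
                                     · exact Or.inl h
                                     · exact Or.inr ⟨hp, h⟩)
  have := setIntegral_prod (μ := volume) (ν := volume) (Function.uncurry g) hi
  rw [← Measure.volume_eq_prod] at this
  simp only [Function.uncurry] at this
  rw [this, setIntegral_univ]
  congr 1
  ext t
  rw [intervalIntegral.integral_of_le hl.le, integral_Ioc_eq_integral_Ioo]

lemma curve_second {E : Type*} [NormedAddCommGroup E] [NormedSpace ℝ E] (u : E → ℝ)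
    (γ γ1 : ℝ → E) (γ2 : E) (s : ℝ) (hu : ContDiffAt ℝ 2 u (γ s))
    (h1 : ∀ r, HasDerivAt γ (γ1 r) r) (h2 : HasDerivAt γ1 γ2 s) (U1 : ℝ → ℝ) (U2 : ℝ)
    (hU1 : ∀ᶠ r in nhds s, HasDerivAt (fun r => u (γ r)) (U1 r) r) (hU2 : HasDerivAt U1 U2 s) :
    U2 = fderiv ℝ (fderiv ℝ u) (γ s) (γ1 s) (γ1 s) + fderiv ℝ u (γ s) γ2 := by
  have hd : ∀ᶠ y in nhds (γ s), DifferentiableAt ℝ u y := by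
    have := hu.eventually (by simp)
    filter_upwards [this] with y hy using hy.differentiableAt (by norm_num)
  have e : U1 =ᶠ[nhds s] fun r => fderiv ℝ u (γ r) (γ1 r) := by
    filter_upwards [hU1, (h1 s).continuousAt.eventually hd] with r hr hd
    exact hr.unique (hd.hasFDerivAt.comp_hasDerivAt r (h1 r))
  have hf : DifferentiableAt ℝ (fderiv ℝ u) (γ s) :=
    (hu.fderiv_right (m := 1) (by norm_num)).differentiableAt (by norm_num)
  have hc : HasDerivAt (fun r => fderiv ℝ u (γ r)) (fderiv ℝ (fderiv ℝ u) (γ s) (γ1 s)) s :=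
    hf.hasFDerivAt.comp_hasDerivAt s (h1 s)
  exact (hU2.congr_of_eventuallyEq e.symm).unique (hc.clm_apply h2)

lemma pm_single (α t x : ℝ) : pm α (t, x) =
    (Real.exp t * Real.cos (α + x)) • EuclideanSpace.single (0 : Fin 2) (1 : ℝ) +
    (Real.exp t * Real.sin (α + x)) • EuclideanSpace.single (1 : Fin 2) (1 : ℝ) := by
  ext i
  fin_cases i <;> simp

lemma hasDerivAt_pm_t (α t x : ℝ) : HasDerivAt (fun s => pm α (s, x)) (pm α (t, x)) t := by
  simp_rw [pm_single]
  exact (((Real.hasDerivAt_exp t).mul_const _).smul_const _).add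
    (((Real.hasDerivAt_exp t).mul_const _).smul_const _)

lemma hasDerivAt_pm_x (α t x : ℝ) :
    HasDerivAt (fun s => pm α (t, s)) (pm (α + Real.pi / 2) (t, x)) x := by
  simp_rw [pm_single]
  have hs : HasDerivAt (fun s => α + s) 1 x := (hasDerivAt_id x).const_add α
  have := (((hs.cos).const_mul (Real.exp t)).smul_const
    (EuclideanSpace.single (0 : Fin 2) (1 : ℝ))).add (((hs.sin).const_mul (Real.exp t)).smul_const
    (EuclideanSpace.single (1 : Fin 2) (1 : ℝ)))
  convert! this using 1
  rw [show α + Real.pi / 2 + x = (α + x) + Real.pi / 2 by ring, Real.cos_add_pi_div_two,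
    Real.sin_add_pi_div_two, mul_one, mul_one]

lemma pm_add_pi (α t x : ℝ) : pm (α + Real.pi / 2 + Real.pi / 2) (t, x) = - pm α (t, x) := by
  have : α + Real.pi / 2 + Real.pi / 2 + x = α + x + Real.pi := by ring
  ext i
  fin_cases i
  · simp [this, Real.cos_add_pi]
  · simp [this, Real.sin_add_pi]

lemma lap_polar (α t x : ℝ) (u : EuclideanSpace ℝ (Fin 2) → ℝ) (hu : ContDiffAt ℝ 2 u (pm α (t, x)))
    (V1 V2 : ℝ → ℝ) (V11 V22 : ℝ)
    (h1 : ∀ᶠ r in nhds t, HasDerivAt (fun r => u (pm α (r, x))) (V1 r) r)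
    (h11 : HasDerivAt V1 V11 t)
    (h2 : ∀ᶠ r in nhds x, HasDerivAt (fun r => u (pm α (t, r))) (V2 r) r)
    (h22 : HasDerivAt V2 V22 x) :
    Real.exp (2 * t) * lap u (pm α (t, x)) = V11 + V22 := by
  rw [curve_second u (fun r => pm α (r, x)) (fun r => pm α (r, x)) (pm α (t, x)) t hu
    (fun r => hasDerivAt_pm_t α r x) (hasDerivAt_pm_t α t x) V1 V11 h1 h11,
    curve_second u (fun r => pm α (t, r)) (fun r => pm (α + Real.pi / 2) (t, r))
      (- pm α (t, x)) x hu (fun r => hasDerivAt_pm_x α t r)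
      (by rw [← pm_add_pi]; exact hasDerivAt_pm_x _ t x) V2 V22 h2 h22]
  unfold lap
  rw [Fin.sum_univ_two, iteratedFDeriv_two_apply, iteratedFDeriv_two_apply]
  set B := fderiv ℝ (fderiv ℝ u) (pm α (t, x))
  rw [map_neg]
  simp only [pm_single, map_add, map_smul, ContinuousLinearMap.add_apply,
    ContinuousLinearMap.smul_apply, smul_eq_mul, Matrix.cons_val_zero, Matrix.cons_val_one]
  rw [show α + Real.pi / 2 + x = (α + x) + Real.pi / 2 by ring, Real.sin_add_pi_div_two,
    Real.cos_add_pi_div_two, two_mul, Real.exp_add]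
  have hcs := Real.sin_sq_add_cos_sq (α + x)
  generalize Real.sin (α + x) = s at *
  generalize Real.cos (α + x) = k at *
  generalize Real.exp t = e
  generalize B (EuclideanSpace.single 0 1) (EuclideanSpace.single 0 1) = b00
  generalize B (EuclideanSpace.single 1 1) (EuclideanSpace.single 1 1) = b11
  linear_combination (- e ^ 2 * (b00 + b11)) * hcs

lemma strip_integrals (c θ : ℝ) (h0 : 0 < θ) (hpi : θ < Real.pi)
    (u : EuclideanSpace ℝ (Fin 2) → ℝ) (w w1 w11 w2 w22 : ℝ → ℝ → ℝ)
    (h : StripC2 (2 * θ) w w1 w11 w2 w22)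
    (hu : ∀ t, ∀ x ∈ Ioo 0 (2 * θ), ContDiffAt ℝ 2 u (pm (c - θ) (t, x)))
    (hw : ∀ t, ∀ x ∈ Ioo 0 (2 * θ), w t x = Real.exp (-t) * u (pm (c - θ) (t, x))) :
    (∫ x in coneOf (arcSet c θ), ‖x‖ ^ (0:ℝ) * (lap u x) ^ 2) =
      (∫ t, ∫ x in (0:ℝ)..(2 * θ), ((w11 t x + 2 * w1 t x) + (w22 t x + w t x)) ^ 2) ∧
    (∫ x in coneOf (arcSet c θ), ‖x‖ ^ ((0:ℝ) - 4) * (u x) ^ 2) =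
      ∫ t, ∫ x in (0:ℝ)..(2 * θ), (w t x) ^ 2 := by
  obtain ⟨R, hR⟩ := h.supp
  have hms : MeasurableSet ((univ : Set ℝ) ×ˢ Ioo 0 (2 * θ)) :=
    MeasurableSet.univ.prod measurableSet_Ioo
  have hw' : ∀ t, ∀ x ∈ Ioo 0 (2 * θ), u (pm (c - θ) (t, x)) = Real.exp t * w t x := by
    intro t x hx
    rw [hw t x hx, ← mul_assoc, ← Real.exp_add]
    simp
  constructor
  · rw [cone_integral c θ hpi, ← strip_integral (2 * θ) (by linarith)
      (fun t x => ((w11 t x + 2 * w1 t x) + (w22 t x + w t x)) ^ 2)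
      ((continuous_pow 2).comp ((h.c11.add (h.c1.const_mul 2)).add (h.c22.add h.c))) R
      (fun t ht x => by simp [hR t ht x])]
    apply setIntegral_congr_fun hms
    rintro ⟨t, x⟩ ⟨-, hx⟩
    have hxc : x ∈ Icc 0 (2 * θ) := Ioo_subset_Icc_self hx
    have key := lap_polar (c - θ) t x u (hu t x hx)
      (fun r => Real.exp r * w r x + Real.exp r * w1 r x) (fun r => Real.exp t * w2 t r)
      ((Real.exp t * w t x + Real.exp t * w1 t x) + (Real.exp t * w1 t x + Real.exp t * w11 t x))
      (Real.exp t * w22 t x)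
      (Eventually.of_forall fun r => by
        simp_rw [hw' _ x hx]
        exact (Real.hasDerivAt_exp r).mul (h.dt1 x hxc r))
      (((Real.hasDerivAt_exp t).mul (h.dt1 x hxc t)).add
        ((Real.hasDerivAt_exp t).mul (h.dt2 x hxc t)))
      (by
        filter_upwards [isOpen_Ioo.mem_nhds hx] with r hr
        have e : (fun r => u (pm (c - θ) (t, r))) =ᶠ[nhds r] fun r => Real.exp t * w t r := by
          filter_upwards [isOpen_Ioo.mem_nhds hr] with r' hr'
          exact hw' t r' hr'
        exact (((h.row t).d1 r hr).const_mul _).congr_of_eventuallyEq e)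
      (((h.row t).d2 x hx).const_mul _)
    simp only [Real.rpow_zero, one_mul]
    have key2 : Real.exp t * lap u (pm (c - θ) (t, x)) =
        (w11 t x + 2 * w1 t x) + (w22 t x + w t x) := by
      have he := Real.exp_pos t
      apply mul_left_cancel₀ he.ne'
      rw [two_mul, Real.exp_add] at key
      linear_combination key
    rw [← key2, two_mul, Real.exp_add]
    ring
  · rw [cone_integral c θ hpi, ← strip_integral (2 * θ) (by linarith)
      (fun t x => (w t x) ^ 2) ((continuous_pow 2).comp h.c) R (fun t ht x => by simp [hR t ht x])]
    apply setIntegral_congr_fun hms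
    rintro ⟨t, x⟩ ⟨-, hx⟩
    simp only [pm_norm]
    rw [hw t x hx, ← Real.exp_mul, mul_pow, ← mul_assoc, ← Real.exp_add, sq (Real.exp _),
      ← Real.exp_add]
    congr 2
    ring


/-- The closed strip. -/
def stripT (ℓ : ℝ) : Set (ℝ × ℝ) := univ ×ˢ Icc 0 ℓ

/-- Clamping to the interval `[0, ℓ]`. -/
def cl (ℓ x : ℝ) : ℝ := max 0 (min x ℓ)

lemma cl_mem (ℓ x : ℝ) (hl : 0 < ℓ) : cl ℓ x ∈ Icc 0 ℓ :=
  ⟨le_max_left _ _, max_le hl.le (min_le_right _ _)⟩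

lemma cl_of_mem (ℓ x : ℝ) (hx : x ∈ Icc 0 ℓ) : cl ℓ x = x := by
  unfold cl
  rw [min_eq_left hx.2, max_eq_right hx.1]

lemma cl_continuous (ℓ : ℝ) : Continuous (cl ℓ) := by
  unfold cl; fun_prop

lemma clamp_continuous (ℓ : ℝ) (hl : 0 < ℓ) (g : ℝ × ℝ → ℝ) (hg : ContinuousOn g (stripT ℓ)) :
    Continuous (Function.uncurry fun t x => g (t, cl ℓ x)) := by
  have := cl_continuous ℓ
  exact hg.comp_continuous (f := fun p : ℝ × ℝ => (p.1, cl ℓ p.2)) (by fun_prop)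
    (fun p => ⟨mem_univ _, cl_mem ℓ p.2 hl⟩)

lemma stripT_uniqueDiff (ℓ : ℝ) (hl : 0 < ℓ) : UniqueDiffOn ℝ (stripT ℓ) :=
  uniqueDiffOn_univ.prod (uniqueDiffOn_Icc hl)

lemma strip_deriv_t (ℓ : ℝ) (g : ℝ × ℝ → ℝ) (hg : DifferentiableOn ℝ g (stripT ℓ))
    (t x : ℝ) (hx : x ∈ Icc 0 ℓ) :
    HasDerivAt (fun s => g (s, x)) (fderivWithin ℝ g (stripT ℓ) (t, x) (1, 0)) t := by
  have h1 := (hg (t, x) ⟨mem_univ _, hx⟩).hasFDerivWithinAt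
  have h2 : HasDerivAt (fun s : ℝ => (s, x)) ((1 : ℝ), (0 : ℝ)) t :=
    (hasDerivAt_id t).prodMk (hasDerivAt_const t x)
  rw [← hasDerivWithinAt_univ]
  have hm : MapsTo (fun s : ℝ => (s, x)) univ (stripT ℓ) := fun s _ => ⟨mem_univ _, hx⟩
  exact h1.comp_hasDerivWithinAt t h2.hasDerivWithinAt hm

lemma strip_deriv_x (ℓ : ℝ) (hl : 0 < ℓ) (g : ℝ × ℝ → ℝ) (hg : DifferentiableOn ℝ g (stripT ℓ))
    (t x : ℝ) (hx : x ∈ Ioo 0 ℓ) :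
    HasDerivAt (fun s => g (t, cl ℓ s))
      (fderivWithin ℝ g (stripT ℓ) (t, cl ℓ x) (0, 1)) x := by
  have hxc : x ∈ Icc 0 ℓ := Ioo_subset_Icc_self hx
  rw [cl_of_mem ℓ x hxc]
  have hn : stripT ℓ ∈ nhds (t, x) := prod_mem_nhds univ_mem (Icc_mem_nhds hx.1 hx.2)
  have h1 := (hg (t, x) ⟨mem_univ _, hxc⟩).hasFDerivWithinAt.hasFDerivAt hn
  have h2 : HasDerivAt (fun s : ℝ => (t, s)) ((0 : ℝ), (1 : ℝ)) x :=
    (hasDerivAt_const x t).prodMk (hasDerivAt_id x)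
  refine (h1.comp_hasDerivAt x h2).congr_of_eventuallyEq ?_
  filter_upwards [isOpen_Ioo.mem_nhds hx] with s hs
  rw [cl_of_mem ℓ s (Ioo_subset_Icc_self hs)]
  rfl

lemma fderivWithin_zero_of_open (g : ℝ × ℝ → ℝ) (T : Set (ℝ × ℝ)) (p : ℝ × ℝ)
    (h : ∀ᶠ q in nhds p, g q = 0) : fderivWithin ℝ g T p = 0 := by
  have : g =ᶠ[nhds p] fun _ => (0:ℝ) := h
  rw [(this.filter_mono nhdsWithin_le_nhds).fderivWithin_eq this.eq_of_nhds]
  simp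

lemma eventually_large (R : ℝ) (p : ℝ × ℝ) (hp : R < |p.1|) : ∀ᶠ q in nhds p, R < |q.1| := by
  have : Continuous fun q : ℝ × ℝ => |q.1| := by fun_prop
  exact this.continuousAt.eventually (lt_mem_nhds hp)

lemma mkStrip (ℓ : ℝ) (hl : 0 < ℓ) (W : ℝ × ℝ → ℝ) (hW : ContDiffOn ℝ 2 W (stripT ℓ))
    (z0 : ∀ t, W (t, 0) = 0) (zl : ∀ t, W (t, ℓ) = 0) (R : ℝ) (hR : ∀ p, R < |p.1| → W p = 0) :
    ∃ w w1 w11 w2 w22 : ℝ → ℝ → ℝ, StripC2 ℓ w w1 w11 w2 w22 ∧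
      (∀ t, ∀ x ∈ Icc 0 ℓ, w t x = W (t, x)) ∧
      (∀ t, ∀ x ∈ Icc 0 ℓ, w2 t x = fderivWithin ℝ W (stripT ℓ) (t, x) (0, 1)) := by
  have hT := stripT_uniqueDiff ℓ hl
  have hD : ContDiffOn ℝ 1 (fderivWithin ℝ W (stripT ℓ)) (stripT ℓ) :=
    hW.fderivWithin hT (by norm_num)
  set a1 : ℝ × ℝ → ℝ := fun p => fderivWithin ℝ W (stripT ℓ) p (1, 0) with ha1
  set a2 : ℝ × ℝ → ℝ := fun p => fderivWithin ℝ W (stripT ℓ) p (0, 1) with ha2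
  have hc1 : ContDiffOn ℝ 1 a1 (stripT ℓ) := hD.clm_apply contDiffOn_const
  have hc2 : ContDiffOn ℝ 1 a2 (stripT ℓ) := hD.clm_apply contDiffOn_const
  set a11 : ℝ × ℝ → ℝ := fun p => fderivWithin ℝ a1 (stripT ℓ) p (1, 0) with ha11
  set a22 : ℝ × ℝ → ℝ := fun p => fderivWithin ℝ a2 (stripT ℓ) p (0, 1) with ha22
  have hc11 : ContinuousOn a11 (stripT ℓ) :=
    (hc1.continuousOn_fderivWithin hT (by norm_num)).clm_apply continuousOn_const
  have hc22 : ContinuousOn a22 (stripT ℓ) :=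
    (hc2.continuousOn_fderivWithin hT (by norm_num)).clm_apply continuousOn_const
  have dW : DifferentiableOn ℝ W (stripT ℓ) := hW.differentiableOn (by norm_num)
  have d1 : DifferentiableOn ℝ a1 (stripT ℓ) := hc1.differentiableOn (by norm_num)
  have d2 : DifferentiableOn ℝ a2 (stripT ℓ) := hc2.differentiableOn (by norm_num)
  have cW := clamp_continuous ℓ hl W hW.continuousOn
  have cA1 := clamp_continuous ℓ hl a1 hc1.continuousOn
  have cA2 := clamp_continuous ℓ hl a2 hc2.continuousOn
  have cA11 := clamp_continuous ℓ hl a11 hc11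
  have cA22 := clamp_continuous ℓ hl a22 hc22
  have row : ∀ {g : ℝ → ℝ → ℝ} (hg : Continuous (Function.uncurry g)) s, Continuous (g s) :=
    fun hg s => hg.comp (by fun_prop : Continuous fun x => (s, x))
  have r1 : ∀ p, R < |p.1| → fderivWithin ℝ W (stripT ℓ) p = 0 := fun p hp =>
    fderivWithin_zero_of_open _ _ _ ((eventually_large R p hp).mono fun q hq => hR q hq)
  have ra1 : ∀ p, R < |p.1| → a1 p = 0 := fun p hp => by simp [ha1, r1 p hp]
  have ra2 : ∀ p, R < |p.1| → a2 p = 0 := fun p hp => by simp [ha2, r1 p hp]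
  refine ⟨fun t x => W (t, cl ℓ x), fun t x => a1 (t, cl ℓ x), fun t x => a11 (t, cl ℓ x),
    fun t x => a2 (t, cl ℓ x), fun t x => a22 (t, cl ℓ x), ⟨cW, cA1, cA11, cA22, ?_, ?_, ?_, ?_⟩,
    ?_, ?_⟩
  · intro x hx t
    simp only [cl_of_mem ℓ x hx]
    exact strip_deriv_t ℓ W dW t x hx
  · intro x hx t
    simp only [cl_of_mem ℓ x hx]
    exact strip_deriv_t ℓ a1 d1 t x hx
  · intro t
    refine ⟨row cW t, row cA2 t, row cA22 t, fun x hx => strip_deriv_x ℓ hl W dW t x hx,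
      fun x hx => strip_deriv_x ℓ hl a2 d2 t x hx, ?_, ?_⟩
    · rw [cl_of_mem ℓ 0 ⟨le_rfl, hl.le⟩]; exact z0 t
    · rw [cl_of_mem ℓ ℓ ⟨hl.le, le_rfl⟩]; exact zl t
  · refine ⟨R, fun t ht x => ⟨hR _ ht, ra1 _ ht, ?_, ?_⟩⟩
    · simp only [ha11]
      rw [fderivWithin_zero_of_open _ _ _
        ((eventually_large R (t, cl ℓ x) ht).mono fun q hq => ra1 q hq)]
      rfl
    · simp only [ha22]
      rw [fderivWithin_zero_of_open _ _ _
        ((eventually_large R (t, cl ℓ x) ht).mono fun q hq => ra2 q hq)]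
      rfl
  · intro t x hx
    simp only [cl_of_mem ℓ x hx]
  · intro t x hx
    simp only [cl_of_mem ℓ x hx, ha2]

lemma strip_pos (ℓ : ℝ) (hl : 0 < ℓ) (w w1 w11 w2 w22 : ℝ → ℝ → ℝ)
    (h : StripC2 ℓ w w1 w11 w2 w22) (t0 x0 : ℝ) (hx : x0 ∈ Icc 0 ℓ) (hn : w t0 x0 ≠ 0) :
    0 < ∫ t, ∫ x in (0:ℝ)..ℓ, (w t x) ^ 2 := by
  obtain ⟨R, hR⟩ := h.supp
  have hcont : Continuous fun t => ∫ x in (0:ℝ)..ℓ, (w t x) ^ 2 := by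
    apply intervalIntegral.continuous_parametric_intervalIntegral_of_continuous'
    exact (continuous_pow 2).comp h.c
  apply hcont.integral_pos_of_hasCompactSupport_nonneg_nonzero (x := t0)
  · apply HasCompactSupport.of_support_subset_isCompact (isCompact_Icc (a := -R) (b := R))
    intro t ht
    by_contra hc
    apply ht
    have : R < |t| := by
      by_contra! hh
      exact hc (abs_le.1 hh)
    simp [hR t this]
  · intro t
    exact intervalIntegral.integral_nonneg hl.le fun x _ => sq_nonneg _
  · apply ne_of_gt
    apply intervalIntegral.integral_pos hl
    · exact ((h.row t0).c0.pow 2).continuousOn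
    · intro x _; exact sq_nonneg _
    · exact ⟨x0, hx, by positivity⟩

lemma navier_strip (c θ : ℝ) (h0 : 0 < θ) (hpi : θ < Real.pi) (u : EuclideanSpace ℝ (Fin 2) → ℝ)
    (hu : NavierAdm (coneOf (arcSet c θ)) u) (hne : ∃ x ∈ coneOf (arcSet c θ), u x ≠ 0) :
    ∃ w w1 w11 w2 w22 : ℝ → ℝ → ℝ, StripC2 (2 * θ) w w1 w11 w2 w22 ∧
      (∫ x in coneOf (arcSet c θ), ‖x‖ ^ (0:ℝ) * (lap u x) ^ 2) =
      (∫ t, ∫ x in (0:ℝ)..(2 * θ), ((w11 t x + 2 * w1 t x) + (w22 t x + w t x)) ^ 2) ∧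
      (∫ x in coneOf (arcSet c θ), ‖x‖ ^ ((0:ℝ) - 4) * (u x) ^ 2) =
        (∫ t, ∫ x in (0:ℝ)..(2 * θ), (w t x) ^ 2) ∧
      0 < (∫ t, ∫ x in (0:ℝ)..(2 * θ), (w t x) ^ 2) ∧
      (∀ t, ∀ x ∈ Icc 0 (2 * θ), w2 t x =
        fderivWithin ℝ (fun p : ℝ × ℝ => Real.exp (-p.1) * u (pm (c - θ) p))
          (stripT (2 * θ)) (t, x) (0, 1)) := by
  obtain ⟨hC, hF, ⟨ε, hε, hz⟩, ⟨R, hRR⟩⟩ := hu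
  have hl : 0 < 2 * θ := by linarith
  have hW : ContDiffOn ℝ 2 (fun p : ℝ × ℝ => Real.exp (-p.1) * u (pm (c - θ) p))
      (stripT (2 * θ)) := by
    apply ContDiffOn.mul (by fun_prop)
    exact hC.comp (pm_contDiff _).contDiffOn
      (fun p hp => pm_mem_closure c θ h0 p.1 p.2 hp.2)
  obtain ⟨w, w1, w11, w2, w22, hs, hw, hw2⟩ := mkStrip (2 * θ) hl _ hW
    (fun t => by
      have := hF _ (pm_mem_frontier c θ h0 hpi t 0 (Or.inl rfl))
      simp [this])
    (fun t => by
      have := hF _ (pm_mem_frontier c θ h0 hpi t (2 * θ) (Or.inr rfl))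
      simp [this])
    (max (-Real.log ε) (Real.log (max R 1)))
    (fun p hp => by
      have hm := max_lt_iff.1 hp
      have : u (pm (c - θ) p) = 0 := by
        rcases le_or_gt 0 p.1 with h | h
        · apply hRR
          rw [pm_norm]
          rw [abs_of_nonneg h] at hm
          calc R ≤ max R 1 := le_max_left _ _
            _ < Real.exp p.1 := (Real.log_lt_iff_lt_exp (by positivity)).1 hm.2
        · apply hz
          rw [pm_norm]
          rw [abs_of_neg h] at hm
          exact (Real.lt_log_iff_exp_lt hε).1 (by linarith [hm.1])
      simp [this])
  have hopen := cone_open c θ h0 hpi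
  obtain ⟨e1, e2⟩ := strip_integrals c θ h0 hpi u w w1 w11 w2 w22 hs
    (fun t x hx => hC.contDiffAt (mem_of_superset
      (hopen.mem_nhds (pm_mem_cone c θ t x hx)) subset_closure))
    (fun t x hx => hw t x (Ioo_subset_Icc_self hx))
  refine ⟨w, w1, w11, w2, w22, hs, e1, e2, ?_, hw2⟩
  obtain ⟨x, hx, hux⟩ := hne
  rw [cone_eq_image] at hx
  obtain ⟨⟨t, y⟩, hy, rfl⟩ := hx
  have hyc : y ∈ Icc 0 (2 * θ) := Ioo_subset_Icc_self hy.2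
  apply strip_pos _ hl _ _ _ _ _ hs t y hyc
  rw [hw t y hyc]
  exact mul_ne_zero (Real.exp_pos _).ne' hux

lemma navier_lower (c θ : ℝ) (h0 : 0 < θ) (hpi : θ < Real.pi) (u : EuclideanSpace ℝ (Fin 2) → ℝ)
    (hu : NavierAdm (coneOf (arcSet c θ)) u) (hne : ∃ x ∈ coneOf (arcSet c θ), u x ≠ 0)
    (μ : ℝ) (hμ : ∀ j, μ ≤ (1 - lamE (2 * θ) j) ^ 2) :
    μ ≤ (∫ x in coneOf (arcSet c θ), ‖x‖ ^ (0:ℝ) * (lap u x) ^ 2) /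
      (∫ x in coneOf (arcSet c θ), ‖x‖ ^ ((0:ℝ) - 4) * (u x) ^ 2) := by
  obtain ⟨w, w1, w11, w2, w22, hs, e1, e2, hp, -⟩ := navier_strip c θ h0 hpi u hu hne
  rw [e1, e2, le_div_iff₀ hp]
  exact strip_navier _ (by linarith) μ w w1 w11 w2 w22 hs
    (fun t => navier_1d _ (by linarith) μ hμ _ _ _ (hs.row t))

lemma dirichlet_navier (c θ : ℝ) (h0 : 0 < θ) (hpi : θ < Real.pi)
    (u : EuclideanSpace ℝ (Fin 2) → ℝ)
    (hu : DirichletAdm (coneOf (arcSet c θ)) u) : NavierAdm (coneOf (arcSet c θ)) u := by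
  obtain ⟨h1, h2, h3⟩ := hu
  refine ⟨h1.contDiffOn, ?_, ?_, ?_⟩
  · intro x hx
    rw [(cone_open c θ h0 hpi).frontier_eq] at hx
    exact image_eq_zero_of_notMem_tsupport fun h => hx.2 (h3 h)
  · have hn : (0 : EuclideanSpace ℝ (Fin 2)) ∉ tsupport u := fun h => (h3 h).1 rfl
    have := (isClosed_tsupport u).isOpen_compl.mem_nhds hn
    obtain ⟨ε, hε, hb⟩ := Metric.mem_nhds_iff.1 this
    refine ⟨ε, hε, fun x hx => image_eq_zero_of_notMem_tsupport (hb ?_)⟩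
    simpa using hx
  · obtain ⟨R, hR⟩ := h2.isCompact.isBounded.exists_norm_le
    refine ⟨R, fun x hx => image_eq_zero_of_notMem_tsupport fun h => ?_⟩
    linarith [hR x h]

lemma dirichlet_lower (c θ : ℝ) (h0 : 0 < θ) (hpi : θ < Real.pi)
    (hθ : (Real.pi / (2 * θ)) ^ 2 = 2 / 5) (u : EuclideanSpace ℝ (Fin 2) → ℝ)
    (hu : DirichletAdm (coneOf (arcSet c θ)) u) (hne : ∃ x ∈ coneOf (arcSet c θ), u x ≠ 0) :
    9 / 25 + 2 / 125 ≤ (∫ x in coneOf (arcSet c θ), ‖x‖ ^ (0:ℝ) * (lap u x) ^ 2) /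
      (∫ x in coneOf (arcSet c θ), ‖x‖ ^ ((0:ℝ) - 4) * (u x) ^ 2) := by
  obtain ⟨w, w1, w11, w2, w22, hs, e1, e2, hp, hw2⟩ :=
    navier_strip c θ h0 hpi u (dirichlet_navier c θ h0 hpi u hu) hne
  have hl : 0 < 2 * θ := by linarith
  have hz : ∀ t x, (x = 0 ∨ x = 2 * θ) → w2 t x = 0 := by
    intro t x hx
    rw [hw2 t x (by rcases hx with rfl | rfl <;> constructor <;> linarith),
      fderivWithin_zero_of_open]
    · rfl
    · have hf := pm_mem_frontier c θ h0 hpi t x hx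
      rw [(cone_open c θ h0 hpi).frontier_eq] at hf
      have hn : pm (c - θ) (t, x) ∉ tsupport u := fun h => hf.2 (hu.2.2 h)
      have := (pm_contDiff (c - θ)).continuous.continuousAt.eventually
        ((isClosed_tsupport u).isOpen_compl.mem_nhds hn)
      filter_upwards [this] with q hq
      rw [image_eq_zero_of_notMem_tsupport hq, mul_zero]
  rw [e1, e2, le_div_iff₀ hp]
  exact strip_navier _ hl _ w w1 w11 w2 w22 hs
    (fun t => dirichlet_1d _ hl hθ _ _ _ (hs.row t) (hz t 0 (Or.inl rfl)) (hz t _ (Or.inr rfl)))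


/-- A smooth cut-off on the line. -/
def chi : ContDiffBump (0 : ℝ) := ⟨1, 2, one_pos, one_lt_two⟩

lemma chi_contDiff : ContDiff ℝ 2 (fun t => chi t) := chi.contDiff

lemma chi_zero_of (t : ℝ) (ht : 2 < |t|) : chi t = 0 := by
  apply chi.zero_of_le_dist
  simpa [chi] using ht.le

lemma deriv_zero_of_large (f : ℝ → ℝ) (hf : ∀ t : ℝ, 2 < |t| → f t = 0) (t : ℝ) (ht : 2 < |t|) :
    deriv f t = 0 := by
  have : f =ᶠ[nhds t] fun _ => (0:ℝ) := by
    have hc : Continuous fun q : ℝ => |q| := by fun_prop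
    filter_upwards [hc.continuousAt.eventually (lt_mem_nhds ht)] with q hq using hf q hq
  rw [this.deriv_eq]
  simp

/-- First derivative of the cut-off. -/
def chi1 : ℝ → ℝ := deriv (fun t => chi t)

/-- Second derivative of the cut-off. -/
def chi2 : ℝ → ℝ := deriv chi1

lemma chi1_contDiff : ContDiff ℝ 1 chi1 := by
  have := chi_contDiff
  rw [show (2 : WithTop ℕ∞) = 1 + 1 by norm_num, contDiff_succ_iff_deriv] at this
  exact this.2.2

lemma chi2_continuous : Continuous chi2 := chi1_contDiff.continuous_deriv le_rfl

lemma chi_hasDerivAt (t : ℝ) : HasDerivAt (fun t => chi t) (chi1 t) t :=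
  (chi_contDiff.differentiable (by norm_num) t).hasDerivAt

lemma chi1_hasDerivAt (t : ℝ) : HasDerivAt chi1 (chi2 t) t :=
  (chi1_contDiff.differentiable (by norm_num) t).hasDerivAt

lemma chi1_zero_of (t : ℝ) (ht : 2 < |t|) : chi1 t = 0 := deriv_zero_of_large _ chi_zero_of t ht
lemma chi2_zero_of (t : ℝ) (ht : 2 < |t|) : chi2 t = 0 := deriv_zero_of_large _ chi1_zero_of t ht

/-- The complex number of a point, rotated by `-c`. -/
def rotC (c : ℝ) (x : EuclideanSpace ℝ (Fin 2)) : ℂ :=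
  ((x 0 : ℂ) + (x 1 : ℂ) * Complex.I) * Complex.exp (-(c : ℂ) * Complex.I)

lemma rotC_contDiff (c : ℝ) : ContDiff ℝ 2 (rotC c) := by
  unfold rotC
  have h : ∀ i : Fin 2, ContDiff ℝ 2 (fun x : EuclideanSpace ℝ (Fin 2) => ((x i : ℝ) : ℂ)) :=
    fun i => Complex.ofRealCLM.contDiff.comp (EuclideanSpace.proj (𝕜 := ℝ) i).contDiff
  exact ((h 0).add ((h 1).mul contDiff_const)).mul contDiff_const

lemma rotC_pm (c θ t y : ℝ) : rotC c (pm (c - θ) (t, y)) =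
    ((Real.exp t : ℝ) : ℂ) * Complex.exp (((y - θ : ℝ) : ℂ) * Complex.I) := by
  unfold rotC
  have e : (((pm (c - θ) (t, y) 0 : ℝ) : ℂ) + ((pm (c - θ) (t, y) 1 : ℝ) : ℂ) * Complex.I) =
      ((Real.exp t : ℝ) : ℂ) * Complex.exp (((c - θ + y : ℝ) : ℂ) * Complex.I) := by
    rw [Complex.exp_mul_I, ← Complex.ofReal_cos, ← Complex.ofReal_sin, pm_zero, pm_one]
    push_cast
    ring
  rw [e, mul_assoc, ← Complex.exp_add]
  congr 2
  push_cast
  ring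

lemma arg_rotC_pm (c θ t y : ℝ) (h1 : θ < Real.pi) (hy : y ∈ Icc 0 (2 * θ)) :
    (rotC c (pm (c - θ) (t, y))).arg = y - θ := by
  rw [rotC_pm, Complex.exp_mul_I, Complex.arg_mul_cos_add_sin_mul_I (Real.exp_pos t)]
  constructor <;> linarith [hy.1, hy.2]

lemma rotC_mem_slit (c θ t y : ℝ) (h1 : θ < Real.pi) (hy : y ∈ Icc 0 (2 * θ)) :
    rotC c (pm (c - θ) (t, y)) ∈ Complex.slitPlane := by
  rw [Complex.mem_slitPlane_iff_arg, arg_rotC_pm c θ t y h1 hy]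
  refine ⟨by linarith [hy.2], ?_⟩
  rw [rotC_pm]
  exact mul_ne_zero (by exact_mod_cast (Real.exp_pos t).ne') (Complex.exp_ne_zero _)

/-- The test function. -/
def testU (c θ k ε : ℝ) (x : EuclideanSpace ℝ (Fin 2)) : ℝ :=
  ‖x‖ * chi (ε * Real.log ‖x‖) * Real.sin (k * ((Complex.log (rotC c x)).im + θ))

lemma testU_pm (c θ k ε t y : ℝ) (h1 : θ < Real.pi) (hy : y ∈ Icc 0 (2 * θ)) :
    testU c θ k ε (pm (c - θ) (t, y)) = Real.exp t * (chi (ε * t) * Real.sin (k * y)) := by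
  unfold testU
  rw [Complex.log_im, arg_rotC_pm c θ t y h1 hy, pm_norm, Real.log_exp]
  rw [show y - θ + θ = y by ring]
  ring

lemma testU_contDiffAt (c θ k ε t y : ℝ) (h1 : θ < Real.pi) (hy : y ∈ Icc 0 (2 * θ)) :
    ContDiffAt ℝ 2 (testU c θ k ε) (pm (c - θ) (t, y)) := by
  have hx := pm_ne_zero (c - θ) (t, y)
  have hn : ContDiffAt ℝ 2 (fun x : EuclideanSpace ℝ (Fin 2) => ‖x‖) (pm (c - θ) (t, y)) :=
    contDiffAt_norm ℝ hx
  have hlog : ContDiffAt ℝ 2 (fun x : EuclideanSpace ℝ (Fin 2) => Real.log ‖x‖)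
      (pm (c - θ) (t, y)) := hn.log (norm_ne_zero_iff.2 hx)
  have hL : ContDiffAt ℝ 2 (fun x => (Complex.log (rotC c x)).im) (pm (c - θ) (t, y)) := by
    have a := ((Complex.contDiffAt_log (n := 2) (rotC_mem_slit c θ t y h1 hy)).restrict_scalars
      ℝ).comp _ (rotC_contDiff c).contDiffAt
    exact Complex.imCLM.contDiff.contDiffAt.comp _ a
  unfold testU
  refine (hn.mul ?_).mul ?_
  · exact chi_contDiff.contDiffAt.comp (pm (c - θ) (t, y)) (contDiffAt_const.mul hlog)
  · exact Real.contDiff_sin.contDiffAt.comp _ (contDiffAt_const.mul (hL.add contDiffAt_const))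

lemma testU_small (c θ k ε : ℝ) (hε : 0 < ε) (x : EuclideanSpace ℝ (Fin 2))
    (hx : ‖x‖ < Real.exp (-(2 / ε))) : testU c θ k ε x = 0 := by
  unfold testU
  rcases eq_or_ne x 0 with rfl | h
  · simp
  · have hn : 0 < ‖x‖ := norm_pos_iff.2 h
    have h1 := (Real.log_lt_iff_lt_exp hn).2 hx
    have h2 : ε * Real.log ‖x‖ < -2 := by
      calc ε * Real.log ‖x‖ < ε * (-(2 / ε)) := mul_lt_mul_of_pos_left h1 hε
        _ = -2 := by field_simp
    rw [chi_zero_of _ (by rw [abs_of_neg (by linarith)]; linarith)]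
    simp

lemma testU_large (c θ k ε : ℝ) (hε : 0 < ε) (x : EuclideanSpace ℝ (Fin 2))
    (hx : Real.exp (2 / ε) < ‖x‖) : testU c θ k ε x = 0 := by
  unfold testU
  have hn : 0 < ‖x‖ := (Real.exp_pos _).trans hx
  have h1 := (Real.lt_log_iff_exp_lt hn).2 hx
  have h2 : 2 < ε * Real.log ‖x‖ := by
    calc (2:ℝ) = ε * (2 / ε) := by field_simp
      _ < ε * Real.log ‖x‖ := mul_lt_mul_of_pos_left h1 hε
  rw [chi_zero_of _ (by rw [abs_of_pos (by linarith)]; linarith)]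
  simp

lemma testU_navier (c θ k ε : ℝ) (h0 : 0 < θ) (h1 : θ < Real.pi) (hε : 0 < ε)
    (hk : Real.sin (k * (2 * θ)) = 0) : NavierAdm (coneOf (arcSet c θ)) (testU c θ k ε) := by
  refine ⟨?_, ?_, ⟨_, Real.exp_pos _, testU_small c θ k ε hε⟩, ⟨_, testU_large c θ k ε hε⟩⟩
  · intro x hx
    apply ContDiffAt.contDiffWithinAt
    rcases eq_or_ne x 0 with rfl | h
    · have : testU c θ k ε =ᶠ[nhds 0] fun _ => (0:ℝ) := by
        filter_upwards [Metric.ball_mem_nhds (0 : EuclideanSpace ℝ (Fin 2))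
          (Real.exp_pos (-(2 / ε)))] with y hy
        exact testU_small c θ k ε hε y (by simpa using hy)
      exact contDiffAt_const.congr_of_eventuallyEq this
    · obtain ⟨y, hy, e⟩ := closure_polar c θ h0 h1 x h hx
      rw [e]
      exact testU_contDiffAt c θ k ε _ y h1 hy
  · intro x hx
    rcases eq_or_ne x 0 with rfl | h
    · simp [testU]
    · obtain ⟨y, hy, e⟩ := frontier_polar c θ h0 h1 x h hx
      rw [e, testU_pm c θ k ε _ y h1 (by rcases hy with rfl | rfl <;> constructor <;> linarith)]
      rcases hy with rfl | rfl
      · simp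
      · simp [hk]

lemma test_strip (ℓ k ε : ℝ) (hε : 0 < ε) (hk : Real.sin (k * ℓ) = 0) :
    StripC2 ℓ (fun t x => chi (ε * t) * Real.sin (k * x))
      (fun t x => chi1 (ε * t) * ε * Real.sin (k * x))
      (fun t x => chi2 (ε * t) * ε * ε * Real.sin (k * x))
      (fun t x => chi (ε * t) * (Real.cos (k * x) * k))
      (fun t x => chi (ε * t) * (-Real.sin (k * x) * k * k)) := by
  have c0 : Continuous (fun t => chi t) := chi_contDiff.continuous
  have c1 : Continuous chi1 := chi1_contDiff.continuous
  have c2 := chi2_continuous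
  have k0 : Continuous fun p : ℝ × ℝ => chi (ε * p.1) :=
    c0.comp (by fun_prop : Continuous fun p : ℝ × ℝ => ε * p.1)
  have k1 : Continuous fun p : ℝ × ℝ => chi1 (ε * p.1) := by fun_prop
  have k2 : Continuous fun p : ℝ × ℝ => chi2 (ε * p.1) := by fun_prop
  have hlin : ∀ t, HasDerivAt (fun s => ε * s) ε t := fun t => by
    simpa using (hasDerivAt_id t).const_mul ε
  have hlk : ∀ t, HasDerivAt (fun s => k * s) k t := fun t => by
    simpa using (hasDerivAt_id t).const_mul k
  refine ⟨?_, ?_, ?_, ?_, ?_, ?_, ?_, ?_⟩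
  · exact k0.mul (by fun_prop : Continuous fun p : ℝ × ℝ => Real.sin (k * p.2))
  · exact (k1.mul continuous_const).mul (by fun_prop : Continuous fun p : ℝ × ℝ => Real.sin (k * p.2))
  · exact ((k2.mul continuous_const).mul continuous_const).mul
      (by fun_prop : Continuous fun p : ℝ × ℝ => Real.sin (k * p.2))
  · exact k0.mul (by fun_prop : Continuous fun p : ℝ × ℝ => -Real.sin (k * p.2) * k * k)
  · intro x _ t
    exact (HasDerivAt.comp t (chi_hasDerivAt (ε * t)) (hlin t)).mul_const _
  · intro x _ t
    exact ((HasDerivAt.comp t (chi1_hasDerivAt (ε * t)) (hlin t)).mul_const _).mul_const _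
  · intro t
    refine ⟨by fun_prop, by fun_prop, by fun_prop, ?_, ?_, by simp, by simp [hk]⟩
    · intro x _
      exact ((hlk x).sin).const_mul _
    · intro x _
      exact (((hlk x).cos).mul_const k).const_mul _
  · refine ⟨2 / ε, fun t ht x => ?_⟩
    have : 2 < |ε * t| := by
      rw [abs_mul, abs_of_pos hε]
      rw [div_lt_iff₀ hε] at ht
      linarith
    simp [chi_zero_of _ this, chi1_zero_of _ this, chi2_zero_of _ this]

/-- Numerator of the quotient of the test functions. -/
def numQ (κ ε : ℝ) : ℝ := ∫ t in Icc (-2:ℝ) 2, (chi2 t * ε * ε + 2 * (chi1 t * ε) + κ * chi t) ^ 2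

lemma numQ_continuous (κ : ℝ) : Continuous (numQ κ) := by
  unfold numQ
  have c0 : Continuous (fun t => chi t) := chi_contDiff.continuous
  have c1 : Continuous chi1 := chi1_contDiff.continuous
  have c2 := chi2_continuous
  have k0 : Continuous fun p : ℝ × ℝ => chi p.2 := c0.comp continuous_snd
  apply continuous_parametric_integral_of_continuous _ isCompact_Icc
  simp only [Function.uncurry_def]
  fun_prop

lemma numQ_eq (κ ε : ℝ) : numQ κ ε = ∫ t, (chi2 t * ε * ε + 2 * (chi1 t * ε) + κ * chi t) ^ 2 := by
  unfold numQ
  apply setIntegral_eq_integral_of_forall_compl_eq_zero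
  intro t ht
  have : 2 < |t| := by
    by_contra! h
    exact ht (abs_le.1 h)
  simp [chi_zero_of _ this, chi1_zero_of _ this, chi2_zero_of _ this]

lemma chi_sq_pos : 0 < ∫ t, (chi t) ^ 2 := by
  have c0 : Continuous (fun t => chi t) := chi_contDiff.continuous
  apply (c0.pow 2).integral_pos_of_hasCompactSupport_nonneg_nonzero (x := 0)
  · apply HasCompactSupport.of_support_subset_isCompact (isCompact_Icc (a := -2) (b := 2))
    intro t ht
    by_contra hc
    apply ht
    have : 2 < |t| := by
      by_contra! hh
      exact hc (abs_le.1 hh)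
    simp [chi_zero_of _ this]
  · intro t; exact sq_nonneg _
  · have : chi 0 = 1 := chi.one_of_mem_closedBall (by simp [chi])
    simp [this]

lemma quot_nonneg (Ω : Set (EuclideanSpace ℝ (Fin 2))) (u : EuclideanSpace ℝ (Fin 2) → ℝ) :
    0 ≤ (∫ x in Ω, ‖x‖ ^ (0:ℝ) * (lap u x) ^ 2) /
      (∫ x in Ω, ‖x‖ ^ ((0:ℝ) - 4) * (u x) ^ 2) := by
  apply div_nonneg <;> apply integral_nonneg <;> intro x <;> positivity

lemma muN_le_quot (c θ k ε : ℝ) (h0 : 0 < θ) (h1 : θ < Real.pi) (hε : 0 < ε)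
    (hk0 : k ≠ 0) (hk : Real.sin (k * (2 * θ)) = 0) :
    muN (coneOf (arcSet c θ)) 0 ≤ numQ (1 - k ^ 2) ε / ∫ t, (chi t) ^ 2 := by
  have hl : 0 < 2 * θ := by linarith
  have hs := test_strip (2 * θ) k ε hε hk
  have hpos : ∃ y ∈ Ioo 0 (2 * θ), Real.sin (k * y) ≠ 0 := by
    by_contra! hh
    have hm : 0 < min θ (Real.pi / (2 * |k|)) := lt_min h0 (by positivity)
    have h2 := hh (min θ (Real.pi / (2 * |k|))) ⟨hm, by
      linarith [min_le_left θ (Real.pi / (2 * |k|))]⟩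
    have hka : 0 < |k| := by positivity
    have h3 : 0 < Real.sin (|k| * min θ (Real.pi / (2 * |k|))) := by
      apply Real.sin_pos_of_pos_of_lt_pi (by positivity)
      calc |k| * min θ (Real.pi / (2 * |k|)) ≤ |k| * (Real.pi / (2 * |k|)) :=
            mul_le_mul_of_nonneg_left (min_le_right _ _) hka.le
        _ = Real.pi / 2 := by field_simp
        _ < Real.pi := by linarith [Real.pi_pos]
    rcases abs_choice k with h | h
    · rw [h] at h3 h2; linarith
    · have : k = -|k| := by rw [h]; ring
      rw [this, neg_mul, Real.sin_neg] at h2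
      simp only [abs_neg, abs_abs] at h2
      linarith
  obtain ⟨y, hy, hyn⟩ := hpos
  have chi00 : chi 0 = 1 := chi.one_of_mem_closedBall (by simp [chi])
  apply csInf_le
  · refine ⟨0, ?_⟩
    rintro q ⟨u, -, -, rfl⟩
    exact quot_nonneg _ _
  · refine ⟨testU c θ k ε, testU_navier c θ k ε h0 h1 hε hk, ⟨pm (c - θ) (0, y),
      pm_mem_cone c θ 0 y hy, ?_⟩, ?_⟩
    · rw [testU_pm c θ k ε 0 y h1 (Ioo_subset_Icc_self hy)]
      simpa [chi00] using hyn
    · obtain ⟨e1, e2⟩ := strip_integrals c θ h0 h1 (testU c θ k ε) _ _ _ _ _ hs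
        (fun t x hx => testU_contDiffAt c θ k ε t x h1 (Ioo_subset_Icc_self hx))
        (fun t x hx => by
          rw [testU_pm c θ k ε t x h1 (Ioo_subset_Icc_self hx), ← mul_assoc, ← Real.exp_add]
          simp)
      rw [e1, e2]
      have f1 : ∀ t, ∫ x in (0:ℝ)..(2 * θ), ((chi2 (ε * t) * ε * ε * Real.sin (k * x) +
          2 * (chi1 (ε * t) * ε * Real.sin (k * x))) + (chi (ε * t) * (-Real.sin (k * x) * k * k) +
          chi (ε * t) * Real.sin (k * x))) ^ 2 =
          (chi2 (ε * t) * ε * ε + 2 * (chi1 (ε * t) * ε) + (1 - k ^ 2) * chi (ε * t)) ^ 2 *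
          ∫ x in (0:ℝ)..(2 * θ), (Real.sin (k * x)) ^ 2 := by
        intro t
        rw [← intervalIntegral.integral_const_mul]
        congr 1
        ext x
        ring
      have f2 : ∀ t, ∫ x in (0:ℝ)..(2 * θ), (chi (ε * t) * Real.sin (k * x)) ^ 2 =
          (chi (ε * t)) ^ 2 * ∫ x in (0:ℝ)..(2 * θ), (Real.sin (k * x)) ^ 2 := by
        intro t
        rw [← intervalIntegral.integral_const_mul]
        congr 1
        ext x
        ring
      simp_rw [f1, f2]
      rw [integral_mul_const, integral_mul_const]
      have S : 0 < ∫ x in (0:ℝ)..(2 * θ), (Real.sin (k * x)) ^ 2 := by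
        apply intervalIntegral.integral_pos hl
        · exact Continuous.continuousOn (by fun_prop)
        · intro x _; exact sq_nonneg _
        · exact ⟨y, Ioo_subset_Icc_self hy, by positivity⟩
      rw [mul_div_mul_right _ _ S.ne']
      have g1 := Measure.integral_comp_mul_left (fun t =>
        (chi2 t * ε * ε + 2 * (chi1 t * ε) + (1 - k ^ 2) * chi t) ^ 2) ε
      have g2 := Measure.integral_comp_mul_left (fun t => (chi t) ^ 2) ε
      rw [g1, g2, numQ_eq, smul_eq_mul, smul_eq_mul, mul_div_mul_left]
      positivity

lemma muN_le (c θ : ℝ) (h0 : 0 < θ) (h1 : θ < Real.pi) (j : ℕ) :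
    muN (coneOf (arcSet c θ)) 0 ≤ (1 - lamE (2 * θ) j) ^ 2 := by
  have hk : Real.sin ((j + 1) * Real.pi / (2 * θ) * (2 * θ)) = 0 := by
    rw [div_mul_cancel₀ _ (by positivity)]
    exact_mod_cast Real.sin_nat_mul_pi (j + 1)
  have hpi := Real.pi_pos
  have hk0 : (j + 1) * Real.pi / (2 * θ) ≠ 0 := by positivity
  set k := (j + 1) * Real.pi / (2 * θ) with hkd
  have hlim : Tendsto (fun ε => numQ (1 - k ^ 2) ε / ∫ t, (chi t) ^ 2) (nhdsWithin 0 (Ioi 0))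
      (nhds (numQ (1 - k ^ 2) 0 / ∫ t, (chi t) ^ 2)) :=
    (((numQ_continuous (1 - k ^ 2)).div_const _).tendsto 0).mono_left nhdsWithin_le_nhds
  have hfin : numQ (1 - k ^ 2) 0 / ∫ t, (chi t) ^ 2 = (1 - lamE (2 * θ) j) ^ 2 := by
    rw [numQ_eq, div_eq_iff chi_sq_pos.ne', ← integral_const_mul]
    congr 1
    ext t
    rw [lamE, ← hkd]
    ring
  rw [← hfin]
  apply ge_of_tendsto hlim
  filter_upwards [self_mem_nhdsWithin] with ε hε
  exact muN_le_quot c θ k ε h0 h1 hε hk0 hk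


/-- Rotation of the plane by the angle `δ`. -/
def rotL (δ : ℝ) : EuclideanSpace ℝ (Fin 2) →L[ℝ] EuclideanSpace ℝ (Fin 2) :=
  LinearMap.toContinuousLinearMap
    { toFun := fun x => !₂[x 0 * Real.cos δ - x 1 * Real.sin δ, x 0 * Real.sin δ + x 1 * Real.cos δ]
      map_add' := by
        intro x y
        ext i
        fin_cases i <;> simp <;> ring
      map_smul' := by
        intro m x
        ext i
        fin_cases i <;> simp <;> ring }

lemma rotL_zero (δ : ℝ) (x : EuclideanSpace ℝ (Fin 2)) :
    rotL δ x 0 = x 0 * Real.cos δ - x 1 * Real.sin δ := rfl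
lemma rotL_one (δ : ℝ) (x : EuclideanSpace ℝ (Fin 2)) :
    rotL δ x 1 = x 0 * Real.sin δ + x 1 * Real.cos δ := rfl

lemma rotL_neg (δ : ℝ) (x : EuclideanSpace ℝ (Fin 2)) : rotL (-δ) (rotL δ x) = x := by
  have h := Real.sin_sq_add_cos_sq δ
  ext i
  fin_cases i
  · simp only [Fin.zero_eta, rotL_zero, rotL_one, Real.cos_neg, Real.sin_neg]
    linear_combination (x 0) * h
  · simp only [Fin.mk_one, rotL_zero, rotL_one, Real.cos_neg, Real.sin_neg]
    linear_combination (x 1) * h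

lemma rotL_pm (δ α : ℝ) (p : ℝ × ℝ) : rotL δ (pm α p) = pm (α + δ) p := by
  have e : α + δ + p.2 = (α + p.2) + δ := by ring
  ext i
  fin_cases i
  · simp only [Fin.zero_eta, rotL_zero, pm_zero, pm_one, e, Real.cos_add]
    ring
  · simp only [Fin.mk_one, rotL_one, pm_zero, pm_one, e, Real.sin_add]
    ring

lemma rotL_single0 (δ : ℝ) : rotL δ (EuclideanSpace.single (0 : Fin 2) (1 : ℝ)) =
    Real.cos δ • EuclideanSpace.single (0 : Fin 2) (1 : ℝ) +
    Real.sin δ • EuclideanSpace.single (1 : Fin 2) (1 : ℝ) := by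
  ext i
  fin_cases i
  · simp [rotL_zero]
  · simp [rotL_one]

lemma rotL_single1 (δ : ℝ) : rotL δ (EuclideanSpace.single (1 : Fin 2) (1 : ℝ)) =
    (-Real.sin δ) • EuclideanSpace.single (0 : Fin 2) (1 : ℝ) +
    Real.cos δ • EuclideanSpace.single (1 : Fin 2) (1 : ℝ) := by
  ext i
  fin_cases i
  · simp [rotL_zero]
  · simp [rotL_one]

lemma lap_rot (δ : ℝ) (u : EuclideanSpace ℝ (Fin 2) → ℝ) (hu : ContDiff ℝ 2 u)
    (x : EuclideanSpace ℝ (Fin 2)) : lap (u ∘ rotL δ) x = lap u (rotL δ x) := by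
  unfold lap
  rw [Fin.sum_univ_two, Fin.sum_univ_two,
    ContinuousLinearMap.iteratedFDeriv_comp_right (rotL δ) hu x (i := 2) (by norm_num)]
  simp only [ContinuousMultilinearMap.compContinuousLinearMap_apply, iteratedFDeriv_two_apply,
    Matrix.cons_val_zero, Matrix.cons_val_one]
  rw [rotL_single0, rotL_single1]
  simp only [map_add, map_smul, add_apply, smul_apply, smul_eq_mul]
  linear_combination (fderiv ℝ (fderiv ℝ u) (rotL δ x) (EuclideanSpace.single 0 1)
    (EuclideanSpace.single 0 1) + fderiv ℝ (fderiv ℝ u) (rotL δ x) (EuclideanSpace.single 1 1)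
    (EuclideanSpace.single 1 1)) * Real.sin_sq_add_cos_sq δ

lemma lap_zero_of (u : EuclideanSpace ℝ (Fin 2) → ℝ) (x : EuclideanSpace ℝ (Fin 2))
    (hx : x ∉ tsupport u) : lap u x = 0 := by
  unfold lap
  have : iteratedFDeriv ℝ 2 u x = 0 := by
    by_contra h
    exact hx (support_iteratedFDeriv_subset 2 h)
  simp [this]

lemma muD_le_of (Ω : Set (EuclideanSpace ℝ (Fin 2))) (u : EuclideanSpace ℝ (Fin 2) → ℝ)
    (hu : DirichletAdm Ω u) (hne : ∃ x ∈ Ω, u x ≠ 0) :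
    muD Ω 0 ≤ (∫ x in Ω, ‖x‖ ^ (0:ℝ) * (lap u x) ^ 2) /
      (∫ x in Ω, ‖x‖ ^ ((0:ℝ) - 4) * (u x) ^ 2) := by
  apply csInf_le
  · refine ⟨0, ?_⟩
    rintro q ⟨u, -, -, rfl⟩
    exact quot_nonneg _ _
  · exact ⟨u, hu, hne, rfl⟩

lemma exists_dirichlet (Ω : Set (EuclideanSpace ℝ (Fin 2))) (hΩ : IsOpen Ω) (hn : Ω.Nonempty) :
    ∃ u, DirichletAdm Ω u ∧ ∃ x ∈ Ω, u x ≠ 0 := by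
  obtain ⟨x, hx⟩ := hn
  obtain ⟨f, h1, h2, h3, -, h5⟩ := exists_contDiff_tsupport_subset (n := 2) (hΩ.mem_nhds hx)
  exact ⟨f, ⟨h3, h2, h1⟩, x, hx, by rw [h5]; exact one_ne_zero⟩

lemma cone_nonempty (c θ : ℝ) (h0 : 0 < θ) : (coneOf (arcSet c θ)).Nonempty :=
  ⟨_, pm_mem_cone c θ 0 θ ⟨h0, by linarith⟩⟩

lemma le_muD (Ω : Set (EuclideanSpace ℝ (Fin 2))) (hΩ : IsOpen Ω) (hn : Ω.Nonempty) (m : ℝ)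
    (h : ∀ u, DirichletAdm Ω u → (∃ x ∈ Ω, u x ≠ 0) →
      m ≤ (∫ x in Ω, ‖x‖ ^ (0:ℝ) * (lap u x) ^ 2) /
      (∫ x in Ω, ‖x‖ ^ ((0:ℝ) - 4) * (u x) ^ 2)) : m ≤ muD Ω 0 := by
  apply le_csInf
  · obtain ⟨u, h1, h2⟩ := exists_dirichlet Ω hΩ hn
    exact ⟨_, u, h1, h2, rfl⟩
  · rintro q ⟨u, h1, h2, rfl⟩
    exact h u h1 h2

lemma muD_mono (Ω Ω' : Set (EuclideanSpace ℝ (Fin 2))) (hΩ : IsOpen Ω) (hΩ' : IsOpen Ω')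
    (hn : Ω.Nonempty) (hs : Ω ⊆ Ω') : muD Ω' 0 ≤ muD Ω 0 := by
  apply le_muD Ω hΩ hn
  rintro u ⟨h1, h2, h3⟩ ⟨x, hx, hux⟩
  have := muD_le_of Ω' u ⟨h1, h2, h3.trans hs⟩ ⟨x, hs hx, hux⟩
  rwa [setIntegral_eq_of_subset_of_forall_diff_eq_zero hΩ'.measurableSet hs,
    setIntegral_eq_of_subset_of_forall_diff_eq_zero hΩ'.measurableSet hs] at this
  · intro y hy
    rw [image_eq_zero_of_notMem_tsupport fun h => hy.2 (h3 h)]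
    simp
  · intro y hy
    rw [lap_zero_of u y fun h => hy.2 (h3 h)]
    simp

lemma rot_integral (c c' θ : ℝ) (h1 : θ < Real.pi) (f g : EuclideanSpace ℝ (Fin 2) → ℝ)
    (h : ∀ α p, f (pm α p) = g (pm (α + (c' - c)) p)) :
    ∫ x in coneOf (arcSet c θ), f x = ∫ x in coneOf (arcSet c' θ), g x := by
  rw [cone_integral c θ h1, cone_integral c' θ h1]
  simp_rw [h]
  rw [show c - θ + (c' - c) = c' - θ by ring]

lemma muD_rot (c c' θ : ℝ) (h0 : 0 < θ) (h1 : θ < Real.pi) :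
    muD (coneOf (arcSet c θ)) 0 ≤ muD (coneOf (arcSet c' θ)) 0 := by
  apply le_muD _ (cone_open c' θ h0 h1) (cone_nonempty c' θ h0)
  rintro u ⟨a1, a2, a3⟩ ⟨x, hx, hux⟩
  have hback : ∀ y, rotL (c' - c) y ∈ coneOf (arcSet c' θ) → y ∈ coneOf (arcSet c θ) := by
    intro y hy
    rw [cone_eq_image] at hy
    obtain ⟨p, hp, e⟩ := hy
    have e2 : y = rotL (-(c' - c)) (pm (c' - θ) p) := by rw [e, rotL_neg]
    rw [e2, rotL_pm, show c' - θ + -(c' - c) = c - θ by ring]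
    exact pm_mem_cone c θ p.1 p.2 hp.2
  have hts : tsupport (u ∘ rotL (c' - c)) ⊆ rotL (c' - c) ⁻¹' tsupport u :=
    closure_minimal (fun y hy => subset_closure hy)
      ((isClosed_tsupport u).preimage (rotL (c' - c)).continuous)
  have hu : DirichletAdm (coneOf (arcSet c θ)) (u ∘ rotL (c' - c)) := by
    refine ⟨a1.comp (rotL (c' - c)).contDiff, ?_, fun y hy => hback y (a3 (hts hy))⟩
    refine (a2.isCompact.image (rotL (-(c' - c))).continuous).of_isClosed_subset
      (isClosed_tsupport _) ?_
    intro y hy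
    exact ⟨rotL (c' - c) y, hts hy, rotL_neg _ _⟩
  have hne : ∃ y ∈ coneOf (arcSet c θ), (u ∘ rotL (c' - c)) y ≠ 0 := by
    rw [cone_eq_image] at hx
    obtain ⟨p, hp, rfl⟩ := hx
    refine ⟨pm (c - θ) p, pm_mem_cone c θ p.1 p.2 hp.2, ?_⟩
    rw [Function.comp_apply, rotL_pm, show c - θ + (c' - c) = c' - θ by ring]
    exact hux
  have := muD_le_of _ _ hu hne
  rwa [rot_integral c c' θ h1 _ (fun x => ‖x‖ ^ (0:ℝ) * (lap u x) ^ 2) (fun α p => by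
      rw [lap_rot _ u a1, rotL_pm, pm_norm, pm_norm]),
    rot_integral c c' θ h1 _ (fun x => ‖x‖ ^ ((0:ℝ) - 4) * (u x) ^ 2) (fun α p => by
      rw [Function.comp_apply, rotL_pm, pm_norm, pm_norm])] at this

lemma half_eq (v : EuclideanSpace ℝ (Fin 2)) (hv : v ≠ 0) :
    ∃ c : ℝ, {x : EuclideanSpace ℝ (Fin 2) | 0 < ⟪x, v⟫} = coneOf (arcSet c (Real.pi / 2)) := by
  obtain ⟨c, -, e0, e1⟩ := exists_polar 0 v
  refine ⟨c, ?_⟩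
  have hn : 0 < ‖v‖ := norm_pos_iff.2 hv
  have hvc : v = ‖v‖ • uvec c := by
    ext i
    fin_cases i
    · simpa [uvec] using e0
    · simpa [uvec] using e1
  rw [cone_eq_inner c _ (by positivity) (by linarith [Real.pi_pos]), Real.cos_pi_div_two]
  ext x
  simp only [mem_ofPred_eq, mul_zero]
  rw [hvc, inner_smul_right]
  exact mul_pos_iff_of_pos_left (by simpa using hn)

lemma cone_mono (c θ θ' : ℝ) (h : θ ≤ θ') : coneOf (arcSet c θ) ⊆ coneOf (arcSet c θ') := by
  rintro x ⟨hx, t, ht, e⟩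
  exact ⟨hx, t, lt_of_lt_of_le ht h, e⟩

lemma muN_eq (c θ : ℝ) (h0 : 0 < θ) (h1 : θ < Real.pi) :
    muN (coneOf (arcSet c θ)) 0 =
      min ((Real.pi ^ 2 / (4 * θ ^ 2) - 1) ^ 2) ((Real.pi ^ 2 / θ ^ 2 - 1) ^ 2) := by
  have hpi := Real.pi_pos
  have l0 : lamE (2 * θ) 0 = Real.pi ^ 2 / (4 * θ ^ 2) := by
    unfold lamE; simp; field_simp; norm_num
  have l1 : lamE (2 * θ) 1 = Real.pi ^ 2 / θ ^ 2 := by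
    unfold lamE; field_simp; norm_num
  have s0 : (Real.pi ^ 2 / (4 * θ ^ 2) - 1) ^ 2 = (1 - lamE (2 * θ) 0) ^ 2 := by rw [l0]; ring
  have s1 : (Real.pi ^ 2 / θ ^ 2 - 1) ^ 2 = (1 - lamE (2 * θ) 1) ^ 2 := by rw [l1]; ring
  rw [s0, s1]
  apply le_antisymm
  · exact le_min (muN_le c θ h0 h1 0) (muN_le c θ h0 h1 1)
  · apply le_csInf
    · obtain ⟨u, a1, a2⟩ := exists_dirichlet _ (cone_open c θ h0 h1) (cone_nonempty c θ h0)
      exact ⟨_, u, dirichlet_navier c θ h0 h1 u a1, a2, rfl⟩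
    · rintro q ⟨u, a1, a2, rfl⟩
      apply navier_lower c θ h0 h1 u a1 a2
      intro j
      rcases Nat.eq_zero_or_pos j with rfl | hj
      · exact min_le_left _ _
      · refine (min_le_right _ _).trans ?_
        have hge : lamE (2 * θ) 1 ≤ lamE (2 * θ) j := by
          unfold lamE
          have : (1:ℝ) ≤ j := by exact_mod_cast hj
          have : ((1:ℕ):ℝ) + 1 ≤ (j:ℝ) + 1 := by push_cast; linarith
          gcongr
        have hgt : 1 ≤ lamE (2 * θ) 1 := by
          rw [l1, one_le_div (by positivity)]
          gcongr
        nlinarith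

lemma star_facts : 0 < Real.pi * Real.sqrt (5 / 8) ∧ Real.pi * Real.sqrt (5 / 8) < Real.pi ∧
    Real.pi / 2 ≤ Real.pi * Real.sqrt (5 / 8) ∧
    (Real.pi * Real.sqrt (5 / 8)) ^ 2 = Real.pi ^ 2 * (5 / 8) := by
  have hpi := Real.pi_pos
  have hs : Real.sqrt (5 / 8) ^ 2 = 5 / 8 := Real.sq_sqrt (by norm_num)
  have hp : 0 < Real.sqrt (5 / 8) := Real.sqrt_pos.2 (by norm_num)
  refine ⟨by positivity, ?_, ?_, by rw [mul_pow, hs]⟩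
  · have : Real.sqrt (5 / 8) < 1 := by nlinarith
    nlinarith
  · have : 1 / 2 ≤ Real.sqrt (5 / 8) := by nlinarith
    nlinarith

lemma muD_star (c : ℝ) :
    9 / 25 + 2 / 125 ≤ muD (coneOf (arcSet c (Real.pi * Real.sqrt (5 / 8)))) 0 := by
  obtain ⟨h0, h1, -, h3⟩ := star_facts
  apply le_muD _ (cone_open c _ h0 h1) (cone_nonempty c _ h0)
  intro u a1 a2
  refine dirichlet_lower c _ h0 h1 ?_ u a1 a2
  rw [div_pow, mul_pow 2, h3]
  have := Real.pi_pos
  field_simp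
  norm_num

lemma muN_star (c : ℝ) : muN (coneOf (arcSet c (Real.pi * Real.sqrt (5 / 8)))) 0 = 9 / 25 := by
  obtain ⟨h0, h1, -, h3⟩ := star_facts
  have := Real.pi_pos
  rw [muN_eq c _ h0 h1, h3,
    show Real.pi ^ 2 / (4 * (Real.pi ^ 2 * (5 / 8))) = 2 / 5 by field_simp; norm_num,
    show Real.pi ^ 2 / (Real.pi ^ 2 * (5 / 8)) = 8 / 5 by field_simp]
  norm_num

lemma muD_half (c : ℝ) (v : EuclideanSpace ℝ (Fin 2)) (hv : v ≠ 0) :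
    muD (coneOf (arcSet c (Real.pi * Real.sqrt (5 / 8)))) 0 ≤
      muD {x : EuclideanSpace ℝ (Fin 2) | 0 < ⟪x, v⟫} 0 := by
  obtain ⟨h0, h1, h2, -⟩ := star_facts
  obtain ⟨c', e⟩ := half_eq v hv
  have hpi := Real.pi_pos
  rw [e]
  exact (muD_rot c c' _ h0 h1).trans (muD_mono _ _ (cone_open c' _ (by linarith) (by linarith))
    (cone_open c' _ h0 h1) (cone_nonempty c' _ (by linarith)) (cone_mono c' _ _ h2))

lemma muN_half (v : EuclideanSpace ℝ (Fin 2)) (hv : v ≠ 0) :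
    muN {x : EuclideanSpace ℝ (Fin 2) | 0 < ⟪x, v⟫} 0 = 0 := by
  obtain ⟨c, e⟩ := half_eq v hv
  have hpi := Real.pi_pos
  rw [e, muN_eq c _ (by linarith) (by linarith),
    show Real.pi ^ 2 / (4 * (Real.pi / 2) ^ 2) = 1 by field_simp; norm_num,
    show Real.pi ^ 2 / (Real.pi / 2) ^ 2 = 4 by field_simp; norm_num]
  norm_num

/-- the Rellich constants of planar sectors for `α = 0`:
`μ_N(C_θ;0) = min{(π²/(4θ²)-1)², (π²/θ²-1)²}`; moreover, with `θ* = π√(5/8)`,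
`μ_D(ℝ²₊;0) ≥ μ_D(C_{θ*};0) > μ_N(C_{θ*};0) = 9/25`, hence `μ_D(ℝ²₊;0) > 9/25`,
whereas `μ_N(ℝ²₊;0) = 0`. -/
theorem rellich_planar_sectors :
    (∀ θ : ℝ, 0 < θ → θ < Real.pi → ∀ c : ℝ,
      muN (coneOf (arcSet c θ)) 0 =
        min ((Real.pi ^ 2 / (4 * θ ^ 2) - 1) ^ 2) ((Real.pi ^ 2 / θ ^ 2 - 1) ^ 2)) ∧
    (∀ c : ℝ,
      muN (coneOf (arcSet c (Real.pi * Real.sqrt (5 / 8)))) 0 = 9 / 25 ∧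
      muN (coneOf (arcSet c (Real.pi * Real.sqrt (5 / 8)))) 0 <
        muD (coneOf (arcSet c (Real.pi * Real.sqrt (5 / 8)))) 0 ∧
      (∀ v : EuclideanSpace ℝ (Fin 2), v ≠ 0 →
        muD (coneOf (arcSet c (Real.pi * Real.sqrt (5 / 8)))) 0 ≤
          muD {x : EuclideanSpace ℝ (Fin 2) | 0 < ⟪x, v⟫} 0)) ∧
    (∀ v : EuclideanSpace ℝ (Fin 2), v ≠ 0 →
      9 / 25 < muD {x : EuclideanSpace ℝ (Fin 2) | 0 < ⟪x, v⟫} 0 ∧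
      muN {x : EuclideanSpace ℝ (Fin 2) | 0 < ⟪x, v⟫} 0 = 0) := by
  refine ⟨fun θ h0 h1 c => muN_eq c θ h0 h1, fun c => ⟨muN_star c, ?_, fun v hv => muD_half c v hv⟩,
    fun v hv => ⟨?_, muN_half v hv⟩⟩
  · rw [muN_star c]
    linarith [muD_star c]
  · linarith [muD_star 0, muD_half 0 v hv]


end
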